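/- arXiv:1805.11635 — 3 statements merged into one kernel-verified Lean document; each statement's English description precedes it below -/
import Mathlib

section
/- Let A be a complex Banach algebra, X a contractive right Banach A-module, E_q(A*) the ‖·‖_{A*}-closure of F_q(A*) in A*, and Φ : E_q(A*)* → F_q(A*)* the dual of the contractive identity embedding (F_q(A*), ‖·‖_q) → (E_q(A*), ‖·‖_{A*}). The following are equivalent: (a) F_q(A*) = E_q(A*) and ‖φ‖_q = ‖φ‖_{A*} for all φ in this common space; (b) Φ is an isometry; (c) ‖Φ(μ)‖ ≥ ‖μ‖ for every μ ∈ E_q(A*)*. Moreover, these equivalent conditions hold whenever the set {x*·x : x* ∈ X*, x ∈ X, ‖x*‖ ≤ 1, ‖x‖ ≤ 1} is ‖·‖_{A*}-dense in the closed unit ball of E_q(A*). -/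
open scoped Topology
open Filter

noncomputable section

/-- The right dual action of `A` on `A*`: `(φ · a) b = φ (a * b)`. -/
def dAct {A : Type*} [NonUnitalNormedRing A] [NormedSpace ℂ A]
    [IsScalarTower ℂ A A] [SMulCommClass ℂ A A]
    (φ : A →L[ℂ] ℂ) (a : A) : A →L[ℂ] ℂ :=
  φ.comp (ContinuousLinearMap.mul ℂ A a)

/-- The canonical map `η : A → S*`, `⟨η a, φ⟩ = ⟨ι φ, a⟩`. -/
def etaMap {A : Type*} [NonUnitalNormedRing A] [NormedSpace ℂ A]
    [IsScalarTower ℂ A A] [SMulCommClass ℂ A A]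
    {S : Type*} [NormedAddCommGroup S] [NormedSpace ℂ S]
    (ι : S →ₗ[ℂ] (A →L[ℂ] ℂ)) (hι : ∀ φ : S, ‖ι φ‖ ≤ ‖φ‖) (a : A) : S →L[ℂ] ℂ :=
  LinearMap.mkContinuous
    { toFun := fun φ => ι φ a
      map_add' := fun φ ψ => by simp
      map_smul' := fun c φ => by simp }
    ‖a‖
    (fun φ => by
      have h1 : ‖ι φ a‖ ≤ ‖ι φ‖ * ‖a‖ := (ι φ).le_opNorm a
      have h2 : ‖ι φ‖ * ‖a‖ ≤ ‖φ‖ * ‖a‖ :=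
        mul_le_mul_of_nonneg_right (hι φ) (norm_nonneg a)
      calc ‖ι φ a‖ ≤ ‖φ‖ * ‖a‖ := h1.trans h2
        _ = ‖a‖ * ‖φ‖ := mul_comm _ _)

/-- The "identity" map from the normed dual to the weak-star dual. -/
def toW {S : Type*} [NormedAddCommGroup S] [NormedSpace ℂ S] (μ : S →L[ℂ] ℂ) :
    WeakDual ℂ S := StrongDual.toWeakDual μ

/-- The "identity" map from the weak-star dual to the normed dual. -/
def ofW {S : Type*} [NormedAddCommGroup S] [NormedSpace ℂ S] (μ : WeakDual ℂ S) :
    S →L[ℂ] ℂ := WeakDual.toStrongDual μ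

/-- coefficient functional `x* · x` of a module action: `(x* · x) a = x* (x · a)`. -/
def coeffFn {A : Type*} [NonUnitalNormedRing A] [NormedSpace ℂ A]
    [IsScalarTower ℂ A A] [SMulCommClass ℂ A A]
    {X : Type*} [NormedAddCommGroup X] [NormedSpace ℂ X]
    (m : X →L[ℂ] A →L[ℂ] X) (xs : X →L[ℂ] ℂ) (x : X) : A →L[ℂ] ℂ :=
  xs.comp (m x)

/-- Membership in the Fourier space `F_q(A*)`. -/
def FqMem {A : Type*} [NonUnitalNormedRing A] [NormedSpace ℂ A]
    [IsScalarTower ℂ A A] [SMulCommClass ℂ A A]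
    {X : Type*} [NormedAddCommGroup X] [NormedSpace ℂ X]
    (m : X →L[ℂ] A →L[ℂ] X) (φ : A →L[ℂ] ℂ) : Prop :=
  ∃ (xs : ℕ → (X →L[ℂ] ℂ)) (x : ℕ → X),
    (Summable fun n => ‖xs n‖ * ‖x n‖) ∧
    ∀ a : A, HasSum (fun n => xs n (m (x n) a)) (φ a)

/-- The Fourier norm `‖·‖_q`. -/
def qNorm {A : Type*} [NonUnitalNormedRing A] [NormedSpace ℂ A]
    [IsScalarTower ℂ A A] [SMulCommClass ℂ A A]
    {X : Type*} [NormedAddCommGroup X] [NormedSpace ℂ X]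
    (m : X →L[ℂ] A →L[ℂ] X) (φ : A →L[ℂ] ℂ) : ℝ :=
  sInf { c : ℝ | ∃ (xs : ℕ → (X →L[ℂ] ℂ)) (x : ℕ → X),
    (Summable fun n => ‖xs n‖ * ‖x n‖) ∧
    (∀ a : A, HasSum (fun n => xs n (m (x n) a)) (φ a)) ∧
    c = ∑' n, ‖xs n‖ * ‖x n‖ }

/-- The weak-star topology on `B(X*)` via its identification with `(X* ⊗ X)*`:
the coarsest topology making `T ↦ Σₙ ⟨T xₙ*, xₙ⟩` continuous for all absolutely
summable sequences. -/
def wstarT (X : Type*) [NormedAddCommGroup X] [NormedSpace ℂ X] :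
    TopologicalSpace ((X →L[ℂ] ℂ) →L[ℂ] (X →L[ℂ] ℂ)) :=
  ⨅ (p : (ℕ → (X →L[ℂ] ℂ)) × (ℕ → X)) (_ : Summable fun n => ‖p.1 n‖ * ‖p.2 n‖),
    TopologicalSpace.induced (fun T => ∑' n, T (p.1 n) (p.2 n)) inferInstance

/-- `Γ_q : A → B(X*)`, `Γ_q(a)(x*) = a · x*`, i.e. `Γ_q(a)(x*)(x) = x*(x · a)`. -/
def GammaQ {A : Type*} [NonUnitalNormedRing A] [NormedSpace ℂ A]
    [IsScalarTower ℂ A A] [SMulCommClass ℂ A A]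
    {X : Type*} [NormedAddCommGroup X] [NormedSpace ℂ X]
    (m : X →L[ℂ] A →L[ℂ] X) (a : A) : (X →L[ℂ] ℂ) →L[ℂ] (X →L[ℂ] ℂ) :=
  (ContinuousLinearMap.compL ℂ X X ℂ).flip (m.flip a)

/-- `M_q`: the weak-star closure of `Γ_q(A)` in `B(X*)`. -/
def Mq {A : Type*} [NonUnitalNormedRing A] [NormedSpace ℂ A]
    [IsScalarTower ℂ A A] [SMulCommClass ℂ A A]
    {X : Type*} [NormedAddCommGroup X] [NormedSpace ℂ X]
    (m : X →L[ℂ] A →L[ℂ] X) : Set ((X →L[ℂ] ℂ) →L[ℂ] (X →L[ℂ] ℂ)) :=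
  @closure _ (wstarT X) (Set.range fun a : A => GammaQ m a)


theorem aux_approx {S E : Type*} [NormedAddCommGroup S] [NormedSpace ℂ S]
    [NormedAddCommGroup E] [NormedSpace ℂ E] (κ : S →L[ℂ] E)
    (h : ∀ μ : E →L[ℂ] ℂ, ‖μ‖ ≤ ‖μ.comp κ‖) (e : E) :
    ∃ s : S, ‖e - κ s‖ ≤ 1 / 2 * ‖e‖ ∧ ‖s‖ ≤ ‖e‖ := by
  rcases eq_or_ne e 0 with rfl | he
  · exact ⟨0, by simp⟩
  have hep : 0 < ‖e‖ := norm_pos_iff.2 he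
  have key : e ∈ closure (κ '' Metric.closedBall 0 ‖e‖) := by
    by_contra hn
    have hconv : Convex ℝ (closure (κ '' Metric.closedBall (0 : S) ‖e‖)) := by
      have h1 : Convex ℝ (Metric.closedBall (0 : S) ‖e‖) := convex_closedBall _ _
      exact (h1.linear_image ((κ : S →ₗ[ℂ] E).restrictScalars ℝ)).closure
    obtain ⟨f, u, hf, hu⟩ := RCLike.geometric_hahn_banach_closed_point (𝕜 := ℂ) hconv
      isClosed_closure hn
    have hf' : ∀ s : S, ‖s‖ ≤ ‖e‖ → (f (κ s)).re < u := fun s hs =>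
      hf _ (subset_closure ⟨s, by simpa using hs, rfl⟩)
    have hu0 : 0 < u := by simpa using hf' 0 (by simp)
    have hb : ‖f.comp κ‖ ≤ u / ‖e‖ := by
      refine ContinuousLinearMap.opNorm_le_bound _ (by positivity) fun s => ?_
      rcases eq_or_ne s 0 with rfl | hs
      · simp
      have hsp : 0 < ‖s‖ := norm_pos_iff.2 hs
      obtain ⟨c, hc, hc2⟩ : ∃ c : ℂ, ‖c‖ = 1 ∧ c * f (κ s) = (‖f (κ s)‖ : ℂ) := by
        rcases eq_or_ne (f (κ s)) 0 with h0 | h0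
        · exact ⟨1, by simp, by simp [h0]⟩
        · refine ⟨(‖f (κ s)‖ : ℂ) / f (κ s), by simp [h0], by field_simp⟩
      have := hf' (((‖e‖ / ‖s‖ : ℝ) : ℂ) • c • s) (by
        rw [norm_smul, norm_smul, hc, Complex.norm_real, Real.norm_of_nonneg (by positivity)]
        field_simp; rfl)
      rw [map_smul, map_smul, map_smul, map_smul, smul_eq_mul, smul_eq_mul, hc2,
        ← Complex.ofReal_mul, Complex.ofReal_re] at this
      change ‖f (κ s)‖ ≤ _
      have h2 := this.le
      rw [div_mul_eq_mul_div, div_le_iff₀ hsp] at h2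
      rw [div_mul_eq_mul_div, le_div_iff₀ hep]
      linarith
    have h1 : (f e).re ≤ ‖f‖ * ‖e‖ := (Complex.re_le_norm _).trans (f.le_opNorm e)
    have h2 : ‖f‖ * ‖e‖ ≤ u / ‖e‖ * ‖e‖ := by gcongr; exact (h f).trans hb
    rw [div_mul_cancel₀ _ hep.ne'] at h2
    have h3 : u < (f e).re := hu
    linarith
  obtain ⟨_, ⟨s, hs, rfl⟩, hd⟩ := Metric.mem_closure_iff.1 key (1 / 2 * ‖e‖) (by positivity)
  exact ⟨s, by rw [← dist_eq_norm]; exact hd.le, by simpa using hs⟩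

theorem aux_surj {S E : Type*} [NormedAddCommGroup S] [NormedSpace ℂ S] [CompleteSpace S]
    [NormedAddCommGroup E] [NormedSpace ℂ E] (f : S →L[ℂ] E)
    (hC : ∀ μ : E →L[ℂ] ℂ, ‖μ‖ ≤ ‖μ.comp f‖) : Function.Surjective f := by
  choose g hg using aux_approx f hC
  let h := fun y => y - f (g y)
  intro y
  have hnle : ∀ n : ℕ, ‖h^[n] y‖ ≤ (1 / 2) ^ n * ‖y‖ := by
    intro n
    induction n with
    | zero => simp
    | succ n IH =>
      rw [Function.iterate_succ_apply']
      apply le_trans (hg _).1 _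
      rw [pow_succ', mul_assoc]
      gcongr
  let u := fun n => g (h^[n] y)
  have su : Summable u := by
    refine Summable.of_norm_bounded (g := fun n => (1 / 2 : ℝ) ^ n * ‖y‖)
      (summable_geometric_two.mul_right _) fun n => (hg _).2.trans (hnle n)
  have fsumeq : ∀ n : ℕ, f (∑ i ∈ Finset.range n, u i) = y - h^[n] y := by
    intro n
    induction n with
    | zero => simp
    | succ n IH =>
      rw [Finset.sum_range_succ, map_add, IH, Function.iterate_succ_apply', sub_add]
  refine ⟨tsum u, ?_⟩
  have L₁ : Tendsto (fun n => f (∑ i ∈ Finset.range n, u i)) atTop (𝓝 (f (tsum u))) :=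
    (f.continuous.tendsto _).comp su.hasSum.tendsto_sum_nat
  simp only [fsumeq] at L₁
  have L₂ : Tendsto (fun n => y - h^[n] y) atTop (𝓝 (y - 0)) := by
    refine tendsto_const_nhds.sub (squeeze_zero_norm hnle ?_)
    rw [← zero_mul ‖y‖]
    exact (tendsto_pow_atTop_nhds_zero_of_lt_one (by norm_num) (by norm_num)).mul_const _
  simpa using tendsto_nhds_unique L₁ L₂

theorem aux_isom {S E : Type*} [NormedAddCommGroup S] [NormedSpace ℂ S] [CompleteSpace S]
    [NormedAddCommGroup E] [NormedSpace ℂ E] [CompleteSpace E] (κ : S →L[ℂ] E)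
    (hinj : Function.Injective κ)
    (hC : ∀ μ : E →L[ℂ] ℂ, ‖μ‖ ≤ ‖μ.comp κ‖) (s : S) : ‖s‖ ≤ ‖κ s‖ := by
  have hsurj := aux_surj κ hC
  let T : S ≃L[ℂ] E := ContinuousLinearEquiv.ofBijective κ
    (LinearMap.ker_eq_bot.2 hinj) (LinearMap.range_eq_top.2 hsurj)
  refine NormedSpace.norm_le_dual_bound ℂ s (norm_nonneg _) fun ν => ?_
  have h1 := hC (ν.comp (T.symm : E →L[ℂ] S))
  have h2 : (ν.comp (T.symm : E →L[ℂ] S)).comp κ = ν := by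
    ext x
    have : T.symm (κ x) = x := T.symm_apply_apply x
    simp [this]
  rw [h2] at h1
  have h3 := (ν.comp (T.symm : E →L[ℂ] S)).le_opNorm (κ s)
  have h4 : (ν.comp (T.symm : E →L[ℂ] S)) (κ s) = ν s := congrArg (fun z => z s) h2
  rw [h4] at h3
  calc _ ≤ _ := h3
    _ ≤ ‖ν‖ * ‖κ s‖ := by gcongr
    _ = _ := mul_comm _ _

theorem aux_norm_le {A : Type*} [NonUnitalNormedRing A] [NormedSpace ℂ A]
    [IsScalarTower ℂ A A] [SMulCommClass ℂ A A]
    {X : Type*} [NormedAddCommGroup X] [NormedSpace ℂ X]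
    (m : X →L[ℂ] A →L[ℂ] X)
    (hmn : ∀ (x : X) (a : A), ‖m x a‖ ≤ ‖x‖ * ‖a‖) (φ : A →L[ℂ] ℂ) (hφ : FqMem m φ) :
    ‖φ‖ ≤ qNorm m φ := by
  obtain ⟨xs, x, h1, h2⟩ := hφ
  refine le_csInf ⟨_, xs, x, h1, h2, rfl⟩ ?_
  rintro c ⟨xs, x, h1, h2, rfl⟩
  refine ContinuousLinearMap.opNorm_le_bound _ (tsum_nonneg fun n => by positivity) fun a => ?_
  rw [← (h2 a).tsum_eq]
  refine tsum_of_norm_bounded (h1.hasSum.mul_right ‖a‖) fun n => ?_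
  calc _ ≤ ‖xs n‖ * ‖m (x n) a‖ := (xs n).le_opNorm _
    _ ≤ ‖xs n‖ * (‖x n‖ * ‖a‖) := by gcongr; exact hmn _ _
    _ = _ := by ring

theorem aux_coeff {A : Type*} [NonUnitalNormedRing A] [NormedSpace ℂ A]
    [IsScalarTower ℂ A A] [SMulCommClass ℂ A A]
    {X : Type*} [NormedAddCommGroup X] [NormedSpace ℂ X]
    (m : X →L[ℂ] A →L[ℂ] X) (xs : X →L[ℂ] ℂ) (x : X) :
    FqMem m (coeffFn m xs x) ∧ qNorm m (coeffFn m xs x) ≤ ‖xs‖ * ‖x‖ := by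
  have hs : HasSum (fun n : ℕ => ‖(Pi.single 0 xs : ℕ → (X →L[ℂ] ℂ)) n‖ *
      ‖(Pi.single 0 x : ℕ → X) n‖) (‖xs‖ * ‖x‖) := by
    convert hasSum_single (f := fun n : ℕ => ‖(Pi.single 0 xs : ℕ → (X →L[ℂ] ℂ)) n‖ *
      ‖(Pi.single 0 x : ℕ → X) n‖) 0 ?_ using 1
    · simp
    · intro n hn
      simp [hn]
  have h2 : ∀ a : A, HasSum (fun n : ℕ => (Pi.single 0 xs : ℕ → (X →L[ℂ] ℂ)) n
      (m ((Pi.single 0 x : ℕ → X) n) a)) (coeffFn m xs x a) := by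
    intro a
    convert hasSum_single (f := fun n : ℕ => (Pi.single 0 xs : ℕ → (X →L[ℂ] ℂ)) n
      (m ((Pi.single 0 x : ℕ → X) n) a)) 0 ?_ using 1
    · simp [coeffFn]
    · intro n hn
      simp [hn]
  refine ⟨⟨_, _, hs.summable, h2⟩, csInf_le ⟨0, ?_⟩ ⟨_, _, hs.summable, h2, hs.tsum_eq.symm⟩⟩
  rintro c ⟨xs, x, -, -, rfl⟩
  exact tsum_nonneg fun n => by positivity

/-- Let `E_q(A*)` be the `‖·‖_{A*}`-closure of `F_q(A*)` in `A*`
(realized isometrically on the Banach space `E` via `ιE`), let `S` realize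
`(F_q(A*), ‖·‖_q)`, and let `κ : S → E` be the identity embedding (so
`Φ : E_q(A*)* → F_q(A*)*` is `μ ↦ μ ∘ κ`).  TFAE:
(a) `F_q(A*) = E_q(A*)` with `‖·‖_q = ‖·‖_{A*}`; (b) `Φ` is an isometry;
(c) `‖Φ μ‖ ≥ ‖μ‖` for all `μ`.  Moreover these hold whenever the contractive
coefficient functionals `x*·x` (`‖x*‖,‖x‖ ≤ 1`) are `‖·‖_{A*}`-dense in the closed
unit ball of `E_q(A*)`. -/
theorem statement_12
    {A : Type*} [NonUnitalNormedRing A] [NormedSpace ℂ A] [CompleteSpace A]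
    [IsScalarTower ℂ A A] [SMulCommClass ℂ A A]
    {X : Type*} [NormedAddCommGroup X] [NormedSpace ℂ X] [CompleteSpace X]
    (m : X →L[ℂ] A →L[ℂ] X)
    (hmn : ∀ (x : X) (a : A), ‖m x a‖ ≤ ‖x‖ * ‖a‖)
    (hma : ∀ (x : X) (a b : A), m (m x a) b = m x (a * b))
    {S : Type*} [NormedAddCommGroup S] [NormedSpace ℂ S] [CompleteSpace S]
    (ιS : S →ₗ[ℂ] (A →L[ℂ] ℂ)) (hinjS : Function.Injective ιS)
    (hrangeS : ∀ φ, FqMem m φ ↔ φ ∈ Set.range ιS)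
    (hnormS : ∀ s : S, ‖s‖ = qNorm m (ιS s))
    {E : Type*} [NormedAddCommGroup E] [NormedSpace ℂ E] [CompleteSpace E]
    (ιE : E →ₗ[ℂ] (A →L[ℂ] ℂ)) (hinjE : Function.Injective ιE)
    (hrangeE : Set.range ιE = closure {φ | FqMem m φ})
    (hnormE : ∀ e : E, ‖e‖ = ‖ιE e‖)
    (κ : S →L[ℂ] E) (hκ : ∀ s : S, ιE (κ s) = ιS s) :
    (( {φ | FqMem m φ} = closure {φ | FqMem m φ} ∧
       (∀ φ, FqMem m φ → qNorm m φ = ‖φ‖) ) ↔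
      (∀ μ : E →L[ℂ] ℂ, ‖μ.comp κ‖ = ‖μ‖)) ∧
    ((∀ μ : E →L[ℂ] ℂ, ‖μ.comp κ‖ = ‖μ‖) ↔
      (∀ μ : E →L[ℂ] ℂ, ‖μ‖ ≤ ‖μ.comp κ‖)) ∧
    ((∀ φ : A →L[ℂ] ℂ, φ ∈ closure {φ | FqMem m φ} → ‖φ‖ ≤ 1 →
        φ ∈ closure {ψ | ∃ (xs : X →L[ℂ] ℂ) (x : X),
          ‖xs‖ ≤ 1 ∧ ‖x‖ ≤ 1 ∧ ψ = coeffFn m xs x}) →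
      (∀ μ : E →L[ℂ] ℂ, ‖μ.comp κ‖ = ‖μ‖)) := by
  have hle : ∀ s, ‖κ s‖ ≤ ‖s‖ := fun s => by
    rw [hnormE, hκ, hnormS]
    exact aux_norm_le m hmn _ ((hrangeS _).2 ⟨s, rfl⟩)
  have hcomp : ∀ μ : E →L[ℂ] ℂ, ‖μ.comp κ‖ ≤ ‖μ‖ := fun μ =>
    ContinuousLinearMap.opNorm_le_bound _ (norm_nonneg _) fun s =>
      (μ.le_opNorm _).trans (by gcongr; exact hle s)
  have hinj : Function.Injective κ := fun s t h => hinjS (by rw [← hκ, ← hκ, h])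
  have hbc : (∀ μ : E →L[ℂ] ℂ, ‖μ.comp κ‖ = ‖μ‖) ↔
      (∀ μ : E →L[ℂ] ℂ, ‖μ‖ ≤ ‖μ.comp κ‖) :=
    ⟨fun h μ => (h μ).ge, fun h μ => le_antisymm (hcomp μ) (h μ)⟩
  refine ⟨⟨?_, ?_⟩, hbc, ?_⟩
  · rintro ⟨h1, h2⟩
    refine hbc.2 fun μ => ContinuousLinearMap.opNorm_le_bound _ (norm_nonneg _) fun e => ?_
    have he : FqMem m (ιE e) := by
      have : ιE e ∈ {φ | FqMem m φ} := by rw [h1, ← hrangeE]; exact ⟨e, rfl⟩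
      exact this
    obtain ⟨s, hs⟩ := (hrangeS _).1 he
    have hse : κ s = e := hinjE (by rw [hκ, hs])
    have h3 := (μ.comp κ).le_opNorm s
    rw [hnormS, hs, h2 _ he, ← hnormE, ContinuousLinearMap.comp_apply, hse] at h3
    exact h3
  · intro h
    have hc := hbc.1 h
    refine ⟨subset_antisymm subset_closure ?_, ?_⟩
    · rw [← hrangeE]
      rintro _ ⟨e, rfl⟩
      obtain ⟨s, rfl⟩ := aux_surj κ hc e
      exact (hrangeS _).2 ⟨s, (hκ s).symm⟩
    · intro φ hφ
      obtain ⟨s, rfl⟩ := (hrangeS φ).1 hφ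
      rw [← hnormS, ← hκ, ← hnormE]
      exact le_antisymm (aux_isom κ hinj hc s) (hle s)
  · intro hd
    refine hbc.2 fun μ => ?_
    have key : ∀ e : E, ‖e‖ ≤ 1 → ‖μ e‖ ≤ ‖μ.comp κ‖ := by
      intro e he
      have hmem : e ∈ closure {e' : E | ‖μ e'‖ ≤ ‖μ.comp κ‖} := by
        refine Metric.mem_closure_iff.2 fun ε hε => ?_
        have h1 := hd (ιE e) (by rw [← hrangeE]; exact ⟨e, rfl⟩) (by rwa [← hnormE])
        obtain ⟨_, ⟨xs, x, hxs, hx, rfl⟩, hdist⟩ := Metric.mem_closure_iff.1 h1 ε hε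
        obtain ⟨hF, hq⟩ := aux_coeff m xs x
        obtain ⟨s, hs⟩ := (hrangeS _).1 hF
        have hs1 : ‖s‖ ≤ 1 := by
          rw [hnormS, hs]
          exact hq.trans (mul_le_one₀ hxs (norm_nonneg _) hx)
        refine ⟨κ s, ?_, ?_⟩
        · exact ((μ.comp κ).le_opNorm s).trans (mul_le_of_le_one_right (norm_nonneg _) hs1)
        · rw [dist_eq_norm, hnormE, map_sub, hκ, hs, ← dist_eq_norm]
          exact hdist
      have hcl : IsClosed {e' : E | ‖μ e'‖ ≤ ‖μ.comp κ‖} :=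
        isClosed_le (by fun_prop) continuous_const
      rw [hcl.closure_eq] at hmem
      exact hmem
    refine ContinuousLinearMap.opNorm_le_bound _ (norm_nonneg _) fun e => ?_
    rcases eq_or_ne e 0 with rfl | he
    · simp
    have hep : 0 < ‖e‖ := norm_pos_iff.2 he
    have h1 := key (((‖e‖⁻¹ : ℝ) : ℂ) • e) (by
      rw [norm_smul, Complex.norm_real, norm_inv, norm_norm, inv_mul_cancel₀ hep.ne'])
    rw [map_smul, norm_smul, Complex.norm_real, norm_inv, norm_norm, inv_mul_le_iff₀ hep] at h1
    linarith


end
end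

section
/- Let A be a complex Banach *-algebra with isometric involution, H a complex Hilbert space, and π : A → B(H) a contractive *-homomorphism. Define π̆ : F_π(A*)* → B(H) by ⟨π̆(μ)ξ, η⟩ = ⟨μ, ξ*_πη⟩ for ξ, η ∈ H (well-defined since ξ*_πη ∈ F_π(A*) with ‖ξ*_πη‖_π ≤ ‖ξ‖‖η‖), and let VN_π denote the closure of π(A) in B(H) in the weak operator topology. Then π̆ is an isometric algebra isomorphism of (F_π(A*)*, ◻) onto VN_π, satisfying π̆(μ*) = π̆(μ)* for the involution μ*(φ) = conjugate of μ(φ*) on F_π(A*)*, π̆∘η_π = π, and π̆ is continuous from the weak* topology of F_π(A*)* to the weak operator topology of B(H). Consequently, the inverse T ↦ μ_T satisfies ⟨μ_T, Σ_n ξ_n*_πη_n⟩ = Σ_n ⟨Tξ_n, η_n⟩ whenever Σ_n ‖ξ_n‖‖η_n‖ < ∞, and (F_π(A*)*, ◻) with this involution is isometrically *-isomorphic to a von Neumann algebra. -/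
open scoped Topology ComplexConjugate
open Filter

noncomputable section

/-- The adjoint functional `φ* : a ↦ conj (φ (a*))`. -/
def phiStar {A : Type*} [NonUnitalNormedRing A] [NormedSpace ℂ A]
    [IsScalarTower ℂ A A] [SMulCommClass ℂ A A]
    [StarRing A] [NormedStarGroup A] [StarModule ℂ A]
    (φ : A →L[ℂ] ℂ) : A →L[ℂ] ℂ :=
  LinearMap.mkContinuous
    { toFun := fun a => conj (φ (star a))
      map_add' := fun a b => by simp [star_add]
      map_smul' := fun c a => by
        simp [star_smul, map_smul, smul_eq_mul, mul_comm] }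
    ‖φ‖
    (fun a => by
      calc ‖conj (φ (star a))‖ = ‖φ (star a)‖ := by simp
        _ ≤ ‖φ‖ * ‖star a‖ := φ.le_opNorm _
        _ = ‖φ‖ * ‖a‖ := by rw [norm_star])

/-- Membership in the Fourier space `F_π(A*)` of a `*`-representation `π`:
`φ = Σₙ ξₙ *_π ηₙ` with `Σ ‖ξₙ‖‖ηₙ‖ < ∞`, where `(ξ *_π η)(a) = ⟨π(a)ξ, η⟩`
(the inner product being linear in its first variable in the paper's convention,
i.e. `inner η (π a ξ)` in Mathlib's convention). -/
def FpiMem {A : Type*} [NonUnitalNormedRing A] [NormedSpace ℂ A]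
    [IsScalarTower ℂ A A] [SMulCommClass ℂ A A]
    {H : Type*} [NormedAddCommGroup H] [InnerProductSpace ℂ H] [CompleteSpace H]
    (π : A →ₗ[ℂ] (H →L[ℂ] H)) (φ : A →L[ℂ] ℂ) : Prop :=
  ∃ ξ η : ℕ → H, (Summable fun n => ‖ξ n‖ * ‖η n‖) ∧
    ∀ a : A, HasSum (fun n => (inner ℂ (η n) (π a (ξ n)) : ℂ)) (φ a)

/-- The Fourier norm `‖·‖_π`. -/
def piNorm {A : Type*} [NonUnitalNormedRing A] [NormedSpace ℂ A]
    [IsScalarTower ℂ A A] [SMulCommClass ℂ A A]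
    {H : Type*} [NormedAddCommGroup H] [InnerProductSpace ℂ H] [CompleteSpace H]
    (π : A →ₗ[ℂ] (H →L[ℂ] H)) (φ : A →L[ℂ] ℂ) : ℝ :=
  sInf { c : ℝ | ∃ ξ η : ℕ → H, (Summable fun n => ‖ξ n‖ * ‖η n‖) ∧
    (∀ a : A, HasSum (fun n => (inner ℂ (η n) (π a (ξ n)) : ℂ)) (φ a)) ∧
    c = ∑' n, ‖ξ n‖ * ‖η n‖ }

/-- The weak operator topology on `B(H)`. -/
def wot (H : Type*) [NormedAddCommGroup H] [InnerProductSpace ℂ H] :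
    TopologicalSpace (H →L[ℂ] H) :=
  ⨅ p : H × H, TopologicalSpace.induced (fun T => (inner ℂ p.2 (T p.1) : ℂ)) inferInstance

/-- `VN_π`: the closure of `π(A)` in the weak operator topology. -/
def VNpi {A : Type*} [NonUnitalNormedRing A] [NormedSpace ℂ A]
    [IsScalarTower ℂ A A] [SMulCommClass ℂ A A]
    {H : Type*} [NormedAddCommGroup H] [InnerProductSpace ℂ H] [CompleteSpace H]
    (π : A →ₗ[ℂ] (H →L[ℂ] H)) : Set (H →L[ℂ] H) :=
  @closure _ (wot H) (Set.range fun a : A => π a)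

section Helpers

variable {H : Type*} [NormedAddCommGroup H] [InnerProductSpace ℂ H]

lemma amp_bound {ι : Type*} (T : H →L[ℂ] H) (x : lp (fun _ : ι => H) 2) :
    Memℓp (fun i => T (x i)) 2 := by
  have h2 : (0 : ℝ) < (2 : ENNReal).toReal := by norm_num
  apply memℓp_gen
  have hx := (memℓp_gen_iff h2).1 x.2
  refine Summable.of_nonneg_of_le (fun i => by positivity) (fun i => ?_)
    (hx.mul_left (‖T‖ ^ (2 : ENNReal).toReal))
  rw [← Real.mul_rpow (norm_nonneg _) (norm_nonneg _)]
  exact Real.rpow_le_rpow (norm_nonneg _) (T.le_opNorm _) h2.le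

/-- The amplification of an operator to `ℓ²(ι, H)`. -/
def amp (ι : Type*) (T : H →L[ℂ] H) :
    lp (fun _ : ι => H) 2 →L[ℂ] lp (fun _ : ι => H) 2 :=
  LinearMap.mkContinuous
    { toFun := fun x => ⟨fun i => T (x i), amp_bound T x⟩
      map_add' := fun x y => by ext i; simp; rfl
      map_smul' := fun c x => by ext i; simp }
    ‖T‖
    (fun x => by
      have h2 : (0 : ℝ) < (2 : ENNReal).toReal := by norm_num
      apply lp.norm_le_of_forall_sum_le h2 (by positivity)
      intro s
      calc ∑ i ∈ s, ‖T (x i)‖ ^ (2 : ENNReal).toReal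
          ≤ ∑ i ∈ s, ‖T‖ ^ (2 : ENNReal).toReal * ‖x i‖ ^ (2 : ENNReal).toReal := by
            apply Finset.sum_le_sum
            intro i _
            rw [← Real.mul_rpow (norm_nonneg _) (norm_nonneg _)]
            exact Real.rpow_le_rpow (norm_nonneg _) (T.le_opNorm _) h2.le
        _ ≤ (‖T‖ * ‖x‖) ^ (2 : ENNReal).toReal := by
            rw [← Finset.mul_sum, Real.mul_rpow (norm_nonneg _) (norm_nonneg _)]
            gcongr
            exact lp.sum_rpow_le_norm_rpow h2 x s)

@[simp] lemma amp_apply {ι : Type*} (T : H →L[ℂ] H) (x : lp (fun _ : ι => H) 2) (i : ι) :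
    amp ι T x i = T (x i) := rfl

lemma amp_single {ι : Type*} [DecidableEq ι] (T : H →L[ℂ] H) (j : ι) (v : H) :
    amp ι T (lp.single 2 j v) = lp.single 2 j (T v) := by
  ext i
  by_cases h : i = j
  · subst h; simp
  · simp [h]

/-- Rescaling of a pair of vectors. -/
lemma rescale (ξ η : H) : ∃ ξ' η' : H, ‖ξ'‖ ^ 2 = ‖ξ‖ * ‖η‖ ∧ ‖η'‖ ^ 2 = ‖ξ‖ * ‖η‖ ∧
    ∀ T : H →L[ℂ] H, (inner ℂ η' (T ξ') : ℂ) = inner ℂ η (T ξ) := by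
  by_cases h1 : ξ = 0
  · exact ⟨0, 0, by simp [h1], by simp [h1], by simp [h1]⟩
  by_cases h2 : η = 0
  · exact ⟨0, 0, by simp [h2], by simp [h2], by simp [h2]⟩
  have p1 : 0 < ‖ξ‖ := norm_pos_iff.2 h1
  have p2 : 0 < ‖η‖ := norm_pos_iff.2 h2
  set t : ℝ := Real.sqrt (‖η‖ / ‖ξ‖) with ht
  have ht0 : 0 < t := Real.sqrt_pos.2 (by positivity)
  have htsq : t ^ 2 = ‖η‖ / ‖ξ‖ := Real.sq_sqrt (by positivity)
  refine ⟨(t : ℂ) • ξ, ((t⁻¹ : ℝ) : ℂ) • η, ?_, ?_, ?_⟩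
  · rw [norm_smul, Complex.norm_real, Real.norm_of_nonneg ht0.le, mul_pow, htsq]
    field_simp
  · rw [norm_smul, Complex.norm_real, Real.norm_of_nonneg (by positivity), mul_pow, inv_pow, htsq]
    field_simp
  · intro T
    have : (t : ℂ) ≠ 0 := by exact_mod_cast ht0.ne'
    rw [map_smul, inner_smul_left, inner_smul_right, Complex.conj_ofReal]
    push_cast
    field_simp

variable [CompleteSpace H]

/-- Double-commutant type argument: an operator commuting with the commutant of the range of `π`
and vanishing on the common kernel preserves the relation `Σ ⟨π(a) ξ_i, η_i⟩ = 0`. -/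
lemma key {A : Type*} [NonUnitalNormedRing A] [NormedSpace ℂ A]
    [IsScalarTower ℂ A A] [SMulCommClass ℂ A A] [StarRing A]
    (π : A →ₗ[ℂ] (H →L[ℂ] H))
    (hπmul : ∀ a b : A, π (a * b) = (π a).comp (π b))
    (hπstar : ∀ a : A, π (star a) = ContinuousLinearMap.adjoint (π a))
    (T : H →L[ℂ] H)
    (hcomm : ∀ X : H →L[ℂ] H, (∀ a, X.comp (π a) = (π a).comp X) → X.comp T = T.comp X)
    (hker : ∀ v : H, (∀ a, π a v = 0) → T v = 0)
    {ι : Type*} (ξ η : ι → H) (hs : Summable fun n => ‖ξ n‖ * ‖η n‖)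
    (h0 : ∀ a : A, HasSum (fun n => (inner ℂ (η n) (π a (ξ n)) : ℂ)) 0) :
    HasSum (fun n => (inner ℂ (η n) (T (ξ n)) : ℂ)) 0 := by
  classical
  choose ξ' η' hξ hη hin using fun n => rescale (ξ n) (η n)
  simp_rw [← hin] at h0 ⊢
  let x : lp (fun _ : ι => H) 2 := ⟨ξ', memℓp_gen (by simpa [hξ] using hs)⟩
  let y : lp (fun _ : ι => H) 2 := ⟨η', memℓp_gen (by simpa [hη] using hs)⟩
  have hxy : ∀ a, (inner ℂ y (amp ι (π a) x) : ℂ) = 0 := fun a =>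
    (lp.hasSum_inner y (amp ι (π a) x)).unique (h0 a)
  suffices hT : (inner ℂ y (amp ι T x) : ℂ) = 0 by
    rw [← hT]; exact lp.hasSum_inner y (amp ι T x)
  -- the cyclic subspace
  let K0 : Submodule ℂ (lp (fun _ : ι => H) 2) :=
    { carrier := Set.range fun a => amp ι (π a) x
      add_mem' := by
        rintro _ _ ⟨a, rfl⟩ ⟨b, rfl⟩
        exact ⟨a + b, by ext i; simp⟩
      zero_mem' := ⟨0, by ext i; simp⟩
      smul_mem' := by
        rintro c _ ⟨a, rfl⟩
        exact ⟨c • a, by ext i; simp⟩ }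
  let K := K0.topologicalClosure
  have : CompleteSpace K := K0.isClosed_topologicalClosure.completeSpace_coe
  have hK0 : ∀ a, amp ι (π a) x ∈ K := fun a => K0.le_topologicalClosure ⟨a, rfl⟩
  have hKinv : ∀ a, ∀ z ∈ K, amp ι (π a) z ∈ K := by
    intro a z hz
    refine map_mem_closure (amp ι (π a)).continuous hz ?_
    rintro _ ⟨b, rfl⟩
    exact ⟨a * b, by ext i; simp [hπmul]⟩
  have hadj : ∀ a (z w : lp (fun _ : ι => H) 2),
      (inner ℂ z (amp ι (π a) w) : ℂ) = inner ℂ (amp ι (π (star a)) z) w := by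
    intro a z w
    rw [lp.inner_eq_tsum, lp.inner_eq_tsum]
    congr 1; ext i
    simp [hπstar, ContinuousLinearMap.adjoint_inner_left]
  have hKperp : ∀ a, ∀ z ∈ Kᗮ, amp ι (π a) z ∈ Kᗮ := by
    intro a z hz
    rw [Submodule.mem_orthogonal] at hz ⊢
    intro u hu
    rw [hadj]
    exact hz _ (hKinv _ u hu)
  let p := K.starProjection
  have hp : ∀ a z, p (amp ι (π a) z) = amp ι (π a) (p z) := by
    intro a z
    refine Submodule.eq_starProjection_of_mem_orthogonal
      (hKinv a _ (Submodule.starProjection_apply_mem _ _)) ?_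
    rw [← map_sub]
    exact hKperp a _ (Submodule.sub_starProjection_mem_orthogonal _)
  -- `amp T` commutes with `p`
  have hTp : ∀ z, p (amp ι T z) = amp ι T (p z) := by
    intro z
    have hz := lp.hasSum_single (p := 2) (by norm_num) z
    have e1 := (p.comp (amp ι T)).hasSum hz
    have e2 := ((amp ι T).comp p).hasSum hz
    suffices hfun : (fun j => (p.comp (amp ι T)) (lp.single 2 j (z j)))
        = fun j => ((amp ι T).comp p) (lp.single 2 j (z j)) by
      rw [hfun] at e1
      exact e1.unique e2
    funext j
    ext i
    let X : H →L[ℂ] H := (lp.evalCLM ℂ (fun _ : ι => H) 2 i).comp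
      (p.comp (lp.singleContinuousLinearMap ℂ (fun _ : ι => H) 2 j))
    have hX : ∀ v, X v = p (lp.single 2 j v) i := fun v => rfl
    have hc := hcomm X (by
      intro a
      ext v
      simp only [ContinuousLinearMap.comp_apply, hX]
      rw [← amp_single, hp, amp_apply])
    have := congrArg (fun Y => Y (z j)) hc
    simp only [ContinuousLinearMap.comp_apply, hX] at this
    simpa [amp_single] using this
  have hz0 : amp ι T (x - p x) = 0 := by
    ext i
    simp only [amp_apply, lp.coeFn_zero, Pi.zero_apply]
    apply hker
    intro a
    have : amp ι (π a) (x - p x) = 0 := by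
      rw [map_sub, ← hp, sub_eq_zero]
      exact (Submodule.starProjection_eq_self_iff.2 (hK0 a)).symm
    have := congrArg (fun z : lp (fun _ : ι => H) 2 => z i) this
    simpa using this
  have hmem : amp ι T x ∈ K := by
    rw [map_sub, sub_eq_zero, ← hTp] at hz0
    rw [hz0]
    exact Submodule.starProjection_apply_mem _ _
  have hcl : IsClosed {z : lp (fun _ : ι => H) 2 | (inner ℂ y z : ℂ) = 0} :=
    isClosed_eq (by fun_prop) continuous_const
  have : K ≤ (⟨⟨⟨{z | (inner ℂ y z : ℂ) = 0}, by
      intro a b ha hb; simp_all⟩, by simp⟩, by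
      intro c a ha; simp_all⟩ : Submodule ℂ (lp (fun _ : ι => H) 2)) := by
    apply Submodule.topologicalClosure_minimal _ _ hcl
    rintro _ ⟨a, rfl⟩
    exact hxy a
  exact this hmem

section Ann

variable {A : Type*} [NonUnitalNormedRing A] [NormedSpace ℂ A]
    [IsScalarTower ℂ A A] [SMulCommClass ℂ A A]

/-- `T` annihilates every finite-rank functional annihilating `π(A)`. -/
def Ann (π : A →ₗ[ℂ] (H →L[ℂ] H)) (T : H →L[ℂ] H) : Prop :=
  ∀ (n : ℕ) (ξ η : Fin n → H), (∀ a, ∑ i, (inner ℂ (η i) (π a (ξ i)) : ℂ) = 0) →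
    ∑ i, (inner ℂ (η i) (T (ξ i)) : ℂ) = 0

lemma wot_eq : wot H = TopologicalSpace.induced
    (fun (T : H →L[ℂ] H) (p : H × H) => (inner ℂ p.2 (T p.1) : ℂ)) inferInstance := by
  rw [induced_to_pi]; rfl

lemma ann_of_mem (π : A →ₗ[ℂ] (H →L[ℂ] H)) (T : H →L[ℂ] H) (hT : T ∈ VNpi π) : Ann π T := by
  intro n ξ η h
  unfold VNpi at hT
  rw [wot_eq, closure_induced] at hT
  have hc : IsClosed {f : H × H → ℂ | ∑ i, f (ξ i, η i) = 0} :=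
    isClosed_eq (by fun_prop) continuous_const
  refine closure_minimal ?_ hc hT
  rintro _ ⟨_, ⟨a, rfl⟩, rfl⟩
  exact h a

lemma mem_of_ann (π : A →ₗ[ℂ] (H →L[ℂ] H)) (T : H →L[ℂ] H) (hT : Ann π T) : T ∈ VNpi π := by
  unfold VNpi
  rw [wot_eq, closure_induced, mem_closure_iff]
  intro o ho hTo
  obtain ⟨I, u, hu, hIu⟩ := isOpen_pi_iff.1 ho _ hTo
  let L : A →ₗ[ℂ] (Fin I.card → ℂ) :=
    { toFun := fun a i => inner ℂ (I.equivFin.symm i).1.2 (π a (I.equivFin.symm i).1.1)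
      map_add' := fun a b => by ext i; simp
      map_smul' := fun c a => by ext i; simp }
  let v : Fin I.card → ℂ :=
    fun i => inner ℂ (I.equivFin.symm i).1.2 (T (I.equivFin.symm i).1.1)
  have hv : v ∈ LinearMap.range L := by
    by_contra hv
    obtain ⟨f, hf, hfk⟩ := Submodule.exists_le_ker_of_notMem hv
    apply hf
    rw [LinearMap.pi_apply_eq_sum_univ f v]
    have := hT I.card
      (fun i => f (fun j => if i = j then 1 else 0) • (I.equivFin.symm i).1.1)
      (fun i => (I.equivFin.symm i).1.2) (by
        intro a
        have h := hfk ⟨a, rfl⟩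
        rw [LinearMap.mem_ker, LinearMap.pi_apply_eq_sum_univ f (L a)] at h
        refine Eq.trans (Finset.sum_congr rfl fun i _ => ?_) h
        simp only [map_smul, inner_smul_right, smul_eq_mul]
        exact mul_comm _ _)
    refine Eq.trans (Finset.sum_congr rfl fun i _ => ?_) this
    simp only [map_smul, inner_smul_right, smul_eq_mul]
    exact mul_comm _ _
  obtain ⟨a, ha⟩ := hv
  refine ⟨_, hIu ?_, ⟨π a, ⟨a, rfl⟩, rfl⟩⟩
  intro q hq
  have := congrFun ha (I.equivFin ⟨q, hq⟩)
  simp only [L, v, LinearMap.coe_mk, AddHom.coe_mk, Equiv.symm_apply_apply] at this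
  simp only [this]
  exact (hu q hq).2

lemma mem_iff_ann (π : A →ₗ[ℂ] (H →L[ℂ] H)) (T : H →L[ℂ] H) : T ∈ VNpi π ↔ Ann π T :=
  ⟨ann_of_mem π T, mem_of_ann π T⟩

lemma ann_comp (π : A →ₗ[ℂ] (H →L[ℂ] H))
    (hπmul : ∀ a b : A, π (a * b) = (π a).comp (π b))
    (T T' : H →L[ℂ] H) (hT : Ann π T) (hT' : Ann π T') : Ann π (T.comp T') := by
  intro n ξ η h
  have h1 : ∀ b, ∑ i, (inner ℂ (η i) (T (π b (ξ i))) : ℂ) = 0 := by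
    intro b
    refine hT n (fun i => π b (ξ i)) η fun a => ?_
    have := h (a * b)
    simpa [hπmul] using this
  have h2 := hT' n ξ (fun i => ContinuousLinearMap.adjoint T (η i)) (by
    intro b
    simpa [ContinuousLinearMap.adjoint_inner_left] using h1 b)
  simpa [ContinuousLinearMap.adjoint_inner_left] using h2

lemma ann_adjoint [StarRing A] (π : A →ₗ[ℂ] (H →L[ℂ] H))
    (hπstar : ∀ a : A, π (star a) = ContinuousLinearMap.adjoint (π a))
    (T : H →L[ℂ] H) (hT : Ann π T) : Ann π (ContinuousLinearMap.adjoint T) := by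
  intro n ξ η h
  have h2 := hT n η ξ (by
    intro b
    have := congrArg conj (h (star b))
    rw [map_sum, map_zero] at this
    simpa [hπstar, ContinuousLinearMap.adjoint_inner_right] using this)
  have := congrArg conj h2
  rw [map_sum, map_zero] at this
  simpa [ContinuousLinearMap.adjoint_inner_right] using this

lemma ann_key [StarRing A] (π : A →ₗ[ℂ] (H →L[ℂ] H))
    (hπmul : ∀ a b : A, π (a * b) = (π a).comp (π b))
    (hπstar : ∀ a : A, π (star a) = ContinuousLinearMap.adjoint (π a))
    (T : H →L[ℂ] H) (hT : Ann π T)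
    {ι : Type*} (ξ η : ι → H) (hs : Summable fun n => ‖ξ n‖ * ‖η n‖)
    (h0 : ∀ a : A, HasSum (fun n => (inner ℂ (η n) (π a (ξ n)) : ℂ)) 0) :
    HasSum (fun n => (inner ℂ (η n) (T (ξ n)) : ℂ)) 0 := by
  refine key π hπmul hπstar T ?_ ?_ ξ η hs h0
  · intro X hX
    ext v
    refine ext_inner_left ℂ fun w => ?_
    have := hT 2 ![X v, v] ![w, - ContinuousLinearMap.adjoint X w] (by
      intro a
      have := congrArg (fun Y => (inner ℂ w (Y v) : ℂ)) (hX a)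
      simp only [ContinuousLinearMap.comp_apply] at this
      simp [Fin.sum_univ_two, ContinuousLinearMap.adjoint_inner_left, this])
    simp only [Fin.sum_univ_two, Matrix.cons_val_zero, Matrix.cons_val_one, inner_neg_left,
      ContinuousLinearMap.adjoint_inner_left] at this
    simp only [ContinuousLinearMap.comp_apply]
    exact (add_neg_eq_zero.1 this).symm
  · intro v hv
    refine ext_inner_left ℂ fun w => ?_
    have := hT 1 ![v] ![w] (by intro a; simp [hv])
    simpa using this

lemma summable_inner_of (T : H →L[ℂ] H) {ι : Type*} (ξ η : ι → H)
    (hs : Summable fun n => ‖ξ n‖ * ‖η n‖) :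
    Summable fun n => ‖(inner ℂ (η n) (T (ξ n)) : ℂ)‖ := by
  refine Summable.of_nonneg_of_le (fun _ => norm_nonneg _) (fun n => ?_) (hs.mul_left ‖T‖)
  calc ‖(inner ℂ (η n) (T (ξ n)) : ℂ)‖ ≤ ‖η n‖ * ‖T (ξ n)‖ := norm_inner_le_norm _ _
    _ ≤ ‖η n‖ * (‖T‖ * ‖ξ n‖) := by gcongr; exact T.le_opNorm _
    _ = _ := by ring

lemma norm_tsum_inner_le (T : H →L[ℂ] H) {ι : Type*} (ξ η : ι → H)
    (hs : Summable fun n => ‖ξ n‖ * ‖η n‖) :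
    ‖∑' n, (inner ℂ (η n) (T (ξ n)) : ℂ)‖ ≤ ‖T‖ * ∑' n, ‖ξ n‖ * ‖η n‖ := by
  refine (norm_tsum_le_tsum_norm (summable_inner_of T ξ η hs)).trans ?_
  rw [← tsum_mul_left]
  refine (summable_inner_of T ξ η hs).tsum_le_tsum (fun n => ?_) (hs.mul_left ‖T‖)
  calc ‖(inner ℂ (η n) (T (ξ n)) : ℂ)‖ ≤ ‖η n‖ * ‖T (ξ n)‖ := norm_inner_le_norm _ _
    _ ≤ ‖η n‖ * (‖T‖ * ‖ξ n‖) := by gcongr; exact T.le_opNorm _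
    _ = _ := by ring

/-- Linear relations between functionals transfer to `T`. -/
lemma ann_rel [StarRing A] (π : A →ₗ[ℂ] (H →L[ℂ] H))
    (hπmul : ∀ a b : A, π (a * b) = (π a).comp (π b))
    (hπstar : ∀ a : A, π (star a) = ContinuousLinearMap.adjoint (π a))
    (T : H →L[ℂ] H) (hT : Ann π T) (c : ℂ) (φ₁ φ₂ φ₃ : A → ℂ)
    (ξ₁ η₁ ξ₂ η₂ ξ₃ η₃ : ℕ → H)
    (s₁ : Summable fun n => ‖ξ₁ n‖ * ‖η₁ n‖) (s₂ : Summable fun n => ‖ξ₂ n‖ * ‖η₂ n‖)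
    (s₃ : Summable fun n => ‖ξ₃ n‖ * ‖η₃ n‖)
    (h₁ : ∀ a : A, HasSum (fun n => (inner ℂ (η₁ n) (π a (ξ₁ n)) : ℂ)) (φ₁ a))
    (h₂ : ∀ a : A, HasSum (fun n => (inner ℂ (η₂ n) (π a (ξ₂ n)) : ℂ)) (φ₂ a))
    (h₃ : ∀ a : A, HasSum (fun n => (inner ℂ (η₃ n) (π a (ξ₃ n)) : ℂ)) (φ₃ a))
    (hφ : ∀ a, φ₃ a = c * φ₁ a + φ₂ a) :
    ∑' n, (inner ℂ (η₃ n) (T (ξ₃ n)) : ℂ) =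
      c * ∑' n, (inner ℂ (η₁ n) (T (ξ₁ n)) : ℂ) + ∑' n, (inner ℂ (η₂ n) (T (ξ₂ n)) : ℂ) := by
  have comb : ∀ (R : H →L[ℂ] H) (x y z : ℂ),
      HasSum (fun n => (inner ℂ (η₁ n) (R (ξ₁ n)) : ℂ)) x →
      HasSum (fun n => (inner ℂ (η₂ n) (R (ξ₂ n)) : ℂ)) y →
      HasSum (fun n => (inner ℂ (η₃ n) (R (ξ₃ n)) : ℂ)) z →
      HasSum (fun n : ℕ ⊕ (ℕ ⊕ ℕ) =>
        (inner ℂ (Sum.elim η₁ (Sum.elim η₂ η₃) n)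
          (R (Sum.elim (fun k => c • ξ₁ k) (Sum.elim ξ₂ (fun k => - ξ₃ k)) n)) : ℂ))
        (c * x + (y + - z)) := by
    intro R x y z hx hy hz
    refine HasSum.sum ?_ (HasSum.sum ?_ ?_)
    · simpa [Function.comp_def, inner_smul_right] using hx.mul_left c
    · simpa [Function.comp_def] using hy
    · simpa [Function.comp_def] using hz.neg
  have k0 := ann_key π hπmul hπstar T hT (ι := ℕ ⊕ (ℕ ⊕ ℕ))
    (Sum.elim (fun k => c • ξ₁ k) (Sum.elim ξ₂ (fun k => - ξ₃ k)))
    (Sum.elim η₁ (Sum.elim η₂ η₃))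
    (by
      refine (HasSum.sum (a := ‖c‖ * ∑' n, ‖ξ₁ n‖ * ‖η₁ n‖) ?_
        (HasSum.sum (a := ∑' n, ‖ξ₂ n‖ * ‖η₂ n‖) (b := ∑' n, ‖ξ₃ n‖ * ‖η₃ n‖)
          ?_ ?_)).summable
      · simpa [Function.comp_def, norm_smul, mul_assoc] using s₁.hasSum.mul_left ‖c‖
      · simpa [Function.comp_def] using s₂.hasSum
      · simpa [Function.comp_def] using s₃.hasSum)
    (by
      intro a
      have := comb (π a) _ _ _ (h₁ a) (h₂ a) (h₃ a)
      rw [hφ a] at this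
      convert this using 1
      ring)
  have k1 := comb T _ _ _ (summable_inner_of T ξ₁ η₁ s₁).of_norm.hasSum
    (summable_inner_of T ξ₂ η₂ s₂).of_norm.hasSum (summable_inner_of T ξ₃ η₃ s₃).of_norm.hasSum
  have := k0.unique k1
  linear_combination this

end Ann

end Helpers

/-- With `S` a realization of the Fourier space
`(F_π(A*), ‖·‖_π)` and `box` its introversion operation, the map
`π̆ : F_π(A*)* → B(H)`, `⟨π̆(μ)ξ, η⟩ = ⟨μ, ξ *_π η⟩`, is an isometric algebra
isomorphism of `(F_π(A*)*, ◻)` onto the weak-operator closed `*`-subalgebra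
`VN_π = closure^{WOT}(π(A))`, a `*`-map for the involution
`μ*(φ) = conj μ(φ*)`, weak-star–WOT continuous, with `π̆ ∘ η_π = π`; its inverse
`T ↦ μ_T` satisfies `⟨μ_T, Σ ξₙ *_π ηₙ⟩ = Σ ⟨T ξₙ, ηₙ⟩`. -/
theorem statement_14
    {A : Type*} [NonUnitalNormedRing A] [NormedSpace ℂ A] [CompleteSpace A]
    [IsScalarTower ℂ A A] [SMulCommClass ℂ A A]
    [StarRing A] [NormedStarGroup A] [StarModule ℂ A]
    {H : Type*} [NormedAddCommGroup H] [InnerProductSpace ℂ H] [CompleteSpace H]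
    (π : A →ₗ[ℂ] (H →L[ℂ] H))
    (hπmul : ∀ a b : A, π (a * b) = (π a).comp (π b))
    (hπstar : ∀ a : A, π (star a) = ContinuousLinearMap.adjoint (π a))
    (hπcontr : ∀ a : A, ‖π a‖ ≤ ‖a‖)
    {S : Type*} [NormedAddCommGroup S] [NormedSpace ℂ S] [CompleteSpace S]
    (ιS : S →ₗ[ℂ] (A →L[ℂ] ℂ)) (hinj : Function.Injective ιS)
    (hrange : ∀ φ, FpiMem π φ ↔ φ ∈ Set.range ιS)
    (hnormS : ∀ s : S, ‖s‖ = piNorm π (ιS s))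
    (hcontrS : ∀ s : S, ‖ιS s‖ ≤ ‖s‖)
    (hactS : ∀ (s : S) (a : A), ∃ u : S, ιS u = dAct (ιS s) a)
    (box : (S →L[ℂ] ℂ) → S → S)
    (hbox : ∀ (ν : S →L[ℂ] ℂ) (s : S) (a : A) (u : S),
      ιS u = dAct (ιS s) a → ιS (box ν s) a = ν u) :
    -- coefficient functionals lie in `F_π(A*)` with `‖ξ *_π η‖_π ≤ ‖ξ‖‖η‖`
    (∀ ξ η : H, ∃ s : S, (∀ a : A, ιS s a = (inner ℂ η (π a ξ) : ℂ)) ∧ ‖s‖ ≤ ‖ξ‖ * ‖η‖) ∧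
    -- `VN_π` is a weak-operator closed `*`-subalgebra of `B(H)`
    @IsClosed _ (wot H) (VNpi π) ∧
    (∀ T T', T ∈ VNpi π → T' ∈ VNpi π → T + T' ∈ VNpi π) ∧
    (∀ (c : ℂ) T, T ∈ VNpi π → c • T ∈ VNpi π) ∧
    (∀ T T', T ∈ VNpi π → T' ∈ VNpi π → T.comp T' ∈ VNpi π) ∧
    (∀ T, T ∈ VNpi π → ContinuousLinearMap.adjoint T ∈ VNpi π) ∧
    -- the representation `π̆`
    (∃ pb : (S →L[ℂ] ℂ) →ₗ[ℂ] (H →L[ℂ] H),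
      -- defining formula `⟨π̆(μ)ξ, η⟩ = ⟨μ, ξ *_π η⟩`
      (∀ (μ : S →L[ℂ] ℂ) (ξ η : H) (s : S),
        (∀ a : A, ιS s a = (inner ℂ η (π a ξ) : ℂ)) → (inner ℂ η (pb μ ξ) : ℂ) = μ s) ∧
      -- isometric
      (∀ μ, ‖pb μ‖ = ‖μ‖) ∧
      -- multiplicative for the first Arens product
      (∀ ar : (S →L[ℂ] ℂ) → (S →L[ℂ] ℂ) → (S →L[ℂ] ℂ),
        (∀ μ ν s, ar μ ν s = μ (box ν s)) →
        ∀ μ ν, pb (ar μ ν) = (pb μ).comp (pb ν)) ∧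
      -- `*`-map for the involution `μ*(φ) = conj μ(φ*)`
      (∀ μ μs : S →L[ℂ] ℂ,
        (∀ s t : S, ιS t = phiStar (ιS s) → μs s = conj (μ t)) →
        pb μs = ContinuousLinearMap.adjoint (pb μ)) ∧
      -- `π̆ ∘ η_π = π`
      (∀ a : A, pb (etaMap ιS hcontrS a) = π a) ∧
      -- onto `VN_π`
      Set.range pb = VNpi π ∧
      -- weak-star–WOT continuous
      (@Continuous (WeakDual ℂ S) _ _ (wot H) (fun μ => pb (ofW μ))) ∧
      -- the inverse `T ↦ μ_T`
      (∀ T, T ∈ VNpi π → ∃ μ : S →L[ℂ] ℂ, pb μ = T ∧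
        ∀ (ξ η : ℕ → H) (s : S),
          (Summable fun n => ‖ξ n‖ * ‖η n‖) →
          (∀ a : A, HasSum (fun n => (inner ℂ (η n) (π a (ξ n)) : ℂ)) (ιS s a)) →
          μ s = ∑' n, (inner ℂ (η n) (T (ξ n)) : ℂ))) := by
  classical
  -- continuity of the evaluation
  have hev : ∀ a : A, ∃ L : S →L[ℂ] ℂ, ∀ s, L s = ιS s a := fun a => ⟨etaMap ιS hcontrS a, fun s => rfl⟩
  have hext : ∀ s t : S, (∀ a, ιS s a = ιS t a) → s = t := fun s t h =>
    hinj (ContinuousLinearMap.ext h)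
  have hle : ∀ (s : S) (ξ η : ℕ → H), (Summable fun n => ‖ξ n‖ * ‖η n‖) →
      (∀ a : A, HasSum (fun n => (inner ℂ (η n) (π a (ξ n)) : ℂ)) (ιS s a)) →
      ‖s‖ ≤ ∑' n, ‖ξ n‖ * ‖η n‖ := by
    intro s ξ η h1 h2
    rw [hnormS]
    refine csInf_le ⟨0, ?_⟩ ⟨ξ, η, h1, h2, rfl⟩
    rintro _ ⟨ξ, η, -, -, rfl⟩
    exact tsum_nonneg fun n => by positivity
  -- bounds via representations
  have hbd : ∀ (s : S) (C r : ℝ), 0 ≤ C →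
      (∀ ξ η : ℕ → H, (Summable fun n => ‖ξ n‖ * ‖η n‖) →
        (∀ a : A, HasSum (fun n => (inner ℂ (η n) (π a (ξ n)) : ℂ)) (ιS s a)) →
        r ≤ C * ∑' n, ‖ξ n‖ * ‖η n‖) → r ≤ C * ‖s‖ := by
    intro s C r hC h
    obtain ⟨ξ, η, h1, h2⟩ := (hrange (ιS s)).2 ⟨s, rfl⟩
    rcases hC.eq_or_lt with rfl | hC
    · simpa using h ξ η h1 h2
    · rw [← div_le_iff₀' hC, hnormS]
      refine le_csInf ⟨_, ξ, η, h1, h2, rfl⟩ ?_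
      rintro _ ⟨ξ, η, h1, h2, rfl⟩
      rw [div_le_iff₀' hC]
      exact h ξ η h1 h2
  -- single coefficients as sequences
  have hsingle : ∀ (R : H →L[ℂ] H) (ξ η : H), HasSum (fun n : ℕ =>
      (inner ℂ ((Pi.single 0 η : ℕ → H) n) (R ((Pi.single 0 ξ : ℕ → H) n)) : ℂ))
      (inner ℂ η (R ξ)) := by
    intro R ξ η
    have := hasSum_single (f := fun n : ℕ =>
      (inner ℂ ((Pi.single 0 η : ℕ → H) n) (R ((Pi.single 0 ξ : ℕ → H) n)) : ℂ)) 0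
      (by intro n hn; simp [hn])
    simpa using this
  have hsingleN : ∀ (ξ η : H), HasSum (fun n : ℕ =>
      ‖(Pi.single 0 ξ : ℕ → H) n‖ * ‖(Pi.single 0 η : ℕ → H) n‖) (‖ξ‖ * ‖η‖) := by
    intro ξ η
    have := hasSum_single (f := fun n : ℕ =>
      ‖(Pi.single 0 ξ : ℕ → H) n‖ * ‖(Pi.single 0 η : ℕ → H) n‖) 0
      (by intro n hn; simp [hn])
    simpa using this
  have hcoef : ∀ ξ η : H, ∃ s : S, (∀ a : A, ιS s a = (inner ℂ η (π a ξ) : ℂ)) ∧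
      ‖s‖ ≤ ‖ξ‖ * ‖η‖ := by
    intro ξ η
    let φ : A →L[ℂ] ℂ := LinearMap.mkContinuous
      { toFun := fun a => (inner ℂ η (π a ξ) : ℂ)
        map_add' := fun a b => by simp [inner_add_right]
        map_smul' := fun c a => by simp [inner_smul_right] } (‖ξ‖ * ‖η‖) (fun a => by
          calc ‖(inner ℂ η (π a ξ) : ℂ)‖ ≤ ‖η‖ * ‖π a ξ‖ := norm_inner_le_norm _ _
            _ ≤ ‖η‖ * (‖a‖ * ‖ξ‖) := by
                gcongr; exact (π a).le_of_opNorm_le (hπcontr a) ξ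
            _ = _ := by ring)
    have hφ : ∀ a, φ a = (inner ℂ η (π a ξ) : ℂ) := fun a => rfl
    obtain ⟨s, hs⟩ := (hrange φ).1 ⟨Pi.single 0 ξ, Pi.single 0 η, (hsingleN ξ η).summable,
      fun a => by rw [hφ]; exact hsingle (π a) ξ η⟩
    refine ⟨s, fun a => by rw [hs, hφ], ?_⟩
    rw [← (hsingleN ξ η).tsum_eq]
    refine hle s _ _ (hsingleN ξ η).summable fun a => ?_
    rw [hs, hφ]; exact hsingle (π a) ξ η
  choose cf hcf hcfn using hcoef
  have hcfu : ∀ ξ η s, (∀ a : A, ιS s a = (inner ℂ η (π a ξ) : ℂ)) → s = cf ξ η := by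
    intro ξ η s h
    exact hext _ _ fun a => by rw [h, hcf]
  -- the sesquilinear coefficient map
  let B0 : H →ₗ⋆[ℂ] H →ₗ[ℂ] S := LinearMap.mk₂'ₛₗ (starRingEnd ℂ) (RingHom.id ℂ)
    (fun η ξ => cf ξ η)
    (fun η η' ξ => hext _ _ fun a => by simp [hcf, inner_add_left])
    (fun c η ξ => hext _ _ fun a => by simp [hcf, inner_smul_left, mul_comm])
    (fun η ξ ξ' => hext _ _ fun a => by simp [hcf, inner_add_right])
    (fun c η ξ => hext _ _ fun a => by simp [hcf, inner_smul_right])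
  have hop : ∀ μ : S →L[ℂ] ℂ, ∃ R : H →L[ℂ] H, ∀ ξ η, (inner ℂ η (R ξ) : ℂ) = μ (cf ξ η) := by
    intro μ
    let B : H →L⋆[ℂ] H →L[ℂ] ℂ := LinearMap.mkContinuous₂ (B0.compr₂ₛₗ μ.toLinearMap) ‖μ‖
      (fun η ξ => by
        calc ‖μ (cf ξ η)‖ ≤ ‖μ‖ * ‖cf ξ η‖ := μ.le_opNorm _
          _ ≤ ‖μ‖ * (‖ξ‖ * ‖η‖) := by gcongr; exact hcfn _ _
          _ = _ := by ring)
    refine ⟨ContinuousLinearMap.adjoint (InnerProductSpace.continuousLinearMapOfBilin B), ?_⟩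
    intro ξ η
    rw [ContinuousLinearMap.adjoint_inner_right,
      InnerProductSpace.continuousLinearMapOfBilin_apply]
    rfl
  choose pb0 hpb0 using hop
  let pb : (S →L[ℂ] ℂ) →ₗ[ℂ] (H →L[ℂ] H) :=
    { toFun := pb0
      map_add' := fun μ ν => by
        ext v; refine ext_inner_left ℂ fun w => ?_
        simp [hpb0, inner_add_right]
      map_smul' := fun c μ => by
        ext v; refine ext_inner_left ℂ fun w => ?_
        simp [hpb0, inner_smul_right] }
  have hpb : ∀ μ ξ η, (inner ℂ η (pb μ ξ) : ℂ) = μ (cf ξ η) := hpb0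
  -- series expansion
  have hser : ∀ (μ : S →L[ℂ] ℂ) (ξ η : ℕ → H) (s : S),
      (Summable fun n => ‖ξ n‖ * ‖η n‖) →
      (∀ a : A, HasSum (fun n => (inner ℂ (η n) (π a (ξ n)) : ℂ)) (ιS s a)) →
      μ s = ∑' n, (inner ℂ (η n) (pb μ (ξ n)) : ℂ) := by
    intro μ ξ η s h1 h2
    have hsum : Summable fun n => cf (ξ n) (η n) :=
      Summable.of_norm_bounded h1 fun n => hcfn _ _
    have hs : s = ∑' n, cf (ξ n) (η n) := by
      refine hext _ _ fun a => ?_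
      obtain ⟨L, hL⟩ := hev a
      have := L.hasSum hsum.hasSum
      rw [← hL (∑' n, cf (ξ n) (η n))]
      simp only [hL, hcf] at this
      rw [hL]
      exact (h2 a).unique this
    have := μ.hasSum hsum.hasSum
    rw [← hs] at this
    simp_rw [hpb]
    exact this.tsum_eq.symm
  have hsub : ∀ μ, pb μ ∈ VNpi π := by
    intro μ
    apply mem_of_ann
    intro n ξ η h
    have h0 : ∑ i, cf (ξ i) (η i) = 0 := by
      refine hext _ _ fun a => ?_
      simpa [hcf] using h a
    simp_rw [hpb]
    rw [← map_sum, h0, map_zero]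
  have hinv : ∀ T, T ∈ VNpi π → ∃ μ : S →L[ℂ] ℂ, pb μ = T := by
    intro T hT
    have hT := ann_of_mem π T hT
    choose X Y hXY hsXY using fun s : S => (hrange (ιS s)).2 ⟨s, rfl⟩
    have hrel := ann_rel π hπmul hπstar T hT
    have z1 : Summable fun n : ℕ => ‖(0 : ℕ → H) n‖ * ‖(0 : ℕ → H) n‖ := by
      simpa using summable_zero
    have z2 : ∀ a : A, HasSum (fun n : ℕ =>
        (inner ℂ ((0 : ℕ → H) n) (π a ((0 : ℕ → H) n)) : ℂ)) ((fun _ : A => (0 : ℂ)) a) := by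
      intro a; simpa using hasSum_zero
    let μ0 : S →ₗ[ℂ] ℂ :=
      { toFun := fun s => ∑' n, (inner ℂ (Y s n) (T (X s n)) : ℂ)
        map_add' := fun s t => by
          have := hrel 1 _ _ _ _ _ _ _ _ _ (hXY s) (hXY t) (hXY (s + t)) (hsXY s) (hsXY t)
            (hsXY (s + t)) (by intro a; simp)
          simpa using this
        map_smul' := fun c s => by
          have := hrel c _ _ _ _ _ _ _ _ _ (hXY s) z1 (hXY (c • s)) (hsXY s) z2
            (hsXY (c • s)) (by intro a; simp)
          simpa using this }
    have hwd : ∀ (s : S) (ξ η : ℕ → H), (Summable fun n => ‖ξ n‖ * ‖η n‖) →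
        (∀ a : A, HasSum (fun n => (inner ℂ (η n) (π a (ξ n)) : ℂ)) (ιS s a)) →
        μ0 s = ∑' n, (inner ℂ (η n) (T (ξ n)) : ℂ) := by
      intro s ξ η h1 h2
      have := hrel 1 _ _ _ _ _ _ _ _ _ h1 z1 (hXY s) h2 z2 (hsXY s) (by intro a; simp)
      simpa [μ0] using this
    let μ : S →L[ℂ] ℂ := μ0.mkContinuous ‖T‖ (fun s => by
      refine hbd s ‖T‖ _ (norm_nonneg _) fun ξ η h1 h2 => ?_
      rw [hwd s ξ η h1 h2]
      exact norm_tsum_inner_le T ξ η h1)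
    refine ⟨μ, ?_⟩
    ext v; refine ext_inner_left ℂ fun w => ?_
    rw [hpb]
    change μ0 (cf v w) = _
    rw [hwd (cf v w) (Pi.single 0 v) (Pi.single 0 w) (hsingleN v w).summable
      (fun a => by rw [hcf]; exact hsingle (π a) v w)]
    exact (hsingle T v w).tsum_eq
  have hrg : Set.range pb = VNpi π := by
    ext T
    constructor
    · rintro ⟨μ, rfl⟩; exact hsub μ
    · intro hT; exact hinv T hT
  refine ⟨fun ξ η => ⟨cf ξ η, hcf ξ η, hcfn ξ η⟩, ?_, ?_, ?_, ?_, ?_, pb, ?_, ?_, ?_, ?_, ?_, hrg,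
    ?_, ?_⟩
  · exact @isClosed_closure _ (wot H) _
  · rw [← hrg]
    rintro _ _ ⟨μ, rfl⟩ ⟨ν, rfl⟩
    exact ⟨μ + ν, map_add _ _ _⟩
  · rw [← hrg]
    rintro c _ ⟨μ, rfl⟩
    exact ⟨c • μ, map_smul _ _ _⟩
  · intro T T' hT hT'
    exact mem_of_ann _ _ (ann_comp π hπmul T T' (ann_of_mem _ _ hT) (ann_of_mem _ _ hT'))
  · intro T hT
    exact mem_of_ann _ _ (ann_adjoint π hπstar T (ann_of_mem _ _ hT))
  · intro μ ξ η s hs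
    rw [hpb, hcfu ξ η s hs]
  · intro μ
    apply le_antisymm
    · refine ContinuousLinearMap.opNorm_le_bound _ (norm_nonneg _) fun v => ?_
      rcases (norm_nonneg (pb μ v)).eq_or_lt with h | h
      · rw [← h]; positivity
      · refine le_of_mul_le_mul_right ?_ h
        calc ‖pb μ v‖ * ‖pb μ v‖ = ‖(inner ℂ (pb μ v) (pb μ v) : ℂ)‖ := by
              rw [inner_self_eq_norm_sq_to_K]; simp [pow_two]
          _ = ‖μ (cf v (pb μ v))‖ := by rw [hpb μ v (pb μ v)]
          _ ≤ ‖μ‖ * ‖cf v (pb μ v)‖ := μ.le_opNorm _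
          _ ≤ ‖μ‖ * (‖v‖ * ‖pb μ v‖) := by gcongr; exact hcfn _ _
          _ = _ := by ring
    · refine ContinuousLinearMap.opNorm_le_bound _ (norm_nonneg _) fun s => ?_
      refine hbd s _ _ (norm_nonneg _) fun ξ η h1 h2 => ?_
      rw [hser μ ξ η s h1 h2]
      exact norm_tsum_inner_le _ ξ η h1
  · intro ar har μ ν
    ext v; refine ext_inner_left ℂ fun w => ?_
    rw [hpb, har, ContinuousLinearMap.comp_apply, hpb]
    congr 1
    refine hext _ _ fun a => ?_
    rw [hbox ν (cf v w) a (cf v (ContinuousLinearMap.adjoint (π a) w)) ?_, hcf, ← hpb,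
      ContinuousLinearMap.adjoint_inner_left]
    ext b
    simp [hcf, dAct, hπmul, ContinuousLinearMap.adjoint_inner_left]
  · intro μ μs h
    ext v; refine ext_inner_left ℂ fun w => ?_
    rw [hpb, ContinuousLinearMap.adjoint_inner_right, h (cf v w) (cf w v) ?_, ← hpb,
      inner_conj_symm]
    ext a
    simp [phiStar, hcf, hπstar, ContinuousLinearMap.adjoint_inner_right]
  · intro a
    ext v; refine ext_inner_left ℂ fun w => ?_
    rw [hpb, ← hcf]
    rfl
  · rw [wot_eq, continuous_induced_rng, continuous_pi_iff]
    intro q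
    simp only [Function.comp_def, hpb]
    exact WeakDual.eval_continuous (cf q.1 q.2)
  · intro T hT
    obtain ⟨μ, rfl⟩ := hinv T hT
    exact ⟨μ, rfl, fun ξ η s h1 h2 => hser μ ξ η s h1 h2⟩

end
end

section
/- Let A be a complex Banach algebra with a contractive right approximate identity, and regard X = A as a contractive right Banach A-module via multiplication, x·a = xa (so the coefficient functional of x* ∈ A* and x ∈ A is x*·x ∈ A*, ⟨x*·x, a⟩ = ⟨x*, xa⟩). Then: (i) LUC(A*) = {φ·a : φ ∈ A*, a ∈ A}, i.e. every element of the closed linear span factors as a single product; (ii) {ψ ∈ LUC(A*) : ‖ψ‖_{A*} < 1} ⊆ {φ·a : ‖φ‖_{A*} ≤ 1, ‖a‖ ≤ 1} ⊆ {ψ ∈ LUC(A*) : ‖ψ‖_{A*} ≤ 1}; and (iii) for this module action, F_q(A*) = LUC(A*) and ‖ψ‖_q = ‖ψ‖_{A*} for every ψ ∈ LUC(A*). -/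
open scoped Topology
open Filter

noncomputable section

section helpers

variable {A : Type*} [NonUnitalNormedRing A] [NormedSpace ℂ A]
    [IsScalarTower ℂ A A] [SMulCommClass ℂ A A]

theorem dAct_apply' (φ : A →L[ℂ] ℂ) (a b : A) : dAct φ a b = φ (a * b) := rfl

theorem norm_dAct_le (φ : A →L[ℂ] ℂ) (a : A) : ‖dAct φ a‖ ≤ ‖φ‖ * ‖a‖ := by
  refine ContinuousLinearMap.opNorm_le_bound _ (by positivity) fun b => ?_
  rw [dAct_apply', mul_assoc]
  exact (φ.le_opNorm _).trans (mul_le_mul_of_nonneg_left (norm_mul_le _ _) (norm_nonneg _))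

/-- The approximate identity acts approximately as the identity on LUC. -/
theorem luc_tendsto {F : Filter A} (hF1 : ∀ᶠ e in F, ‖e‖ ≤ 1)
    (hF2 : ∀ a : A, Tendsto (fun e => a * e) F (𝓝 a)) (ψ : A →L[ℂ] ℂ)
    (hψ : ψ ∈ closure
      (Submodule.span ℂ {ψ : A →L[ℂ] ℂ | ∃ (φ : A →L[ℂ] ℂ) (a : A), ψ = dAct φ a} :
        Set (A →L[ℂ] ℂ))) (ε : ℝ) (hε : 0 < ε) :
    ∀ᶠ e in F, ‖dAct ψ e - ψ‖ ≤ ε := by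
  have hspan : ∀ χ ∈ Submodule.span ℂ
      {ψ : A →L[ℂ] ℂ | ∃ (φ : A →L[ℂ] ℂ) (a : A), ψ = dAct φ a},
      Tendsto (fun e => dAct χ e) F (𝓝 χ) := by
    intro χ hχ
    induction hχ using Submodule.span_induction with
    | mem x hx =>
      obtain ⟨φ, a, rfl⟩ := hx
      have h1 : ∀ e, dAct (dAct φ a) e = dAct φ (a * e) := by
        intro e; ext b; simp [dAct_apply', mul_assoc]
      simp only [h1]
      rw [tendsto_iff_norm_sub_tendsto_zero]
      have h2 := (tendsto_iff_norm_sub_tendsto_zero.1 (hF2 a)).const_mul ‖φ‖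
      rw [mul_zero] at h2
      refine squeeze_zero (fun _ => norm_nonneg _) (fun e => ?_) h2
      have h3 : dAct φ (a * e) - dAct φ a = dAct φ (a * e - a) := by
        ext b; simp [dAct_apply', sub_mul]
      rw [h3]
      exact norm_dAct_le _ _
    | zero =>
      have h1 : ∀ e : A, dAct (0 : A →L[ℂ] ℂ) e = 0 := by intro e; ext b; simp [dAct_apply']
      simp only [h1]
      exact tendsto_const_nhds
    | add x y _ _ hx hy =>
      have h1 : ∀ e : A, dAct (x + y) e = dAct x e + dAct y e := by
        intro e; ext b; simp [dAct_apply']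
      simp only [h1]
      exact hx.add hy
    | smul c x _ hx =>
      have h1 : ∀ e : A, dAct (c • x) e = c • dAct x e := by
        intro e; ext b; simp [dAct_apply']
      simp only [h1]
      exact hx.const_smul c
  obtain ⟨χ, hχ, hd⟩ := Metric.mem_closure_iff.1 hψ (ε / 3) (by positivity)
  have h1 := (tendsto_iff_norm_sub_tendsto_zero.1 (hspan χ hχ)).eventually
    (gt_mem_nhds (show (0 : ℝ) < ε / 3 by positivity))
  filter_upwards [hF1, h1] with e he1 he2
  have h3 : dAct ψ e - ψ = dAct (ψ - χ) e + (dAct χ e - χ) - (ψ - χ) := by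
    ext b; simp [dAct_apply']
  rw [dist_eq_norm] at hd
  have h4 := norm_dAct_le (ψ - χ) e
  have h5 : ‖ψ - χ‖ * ‖e‖ ≤ ‖ψ - χ‖ * 1 := mul_le_mul_of_nonneg_left he1 (norm_nonneg _)
  rw [h3]
  have h6 := norm_sub_le (dAct (ψ - χ) e + (dAct χ e - χ)) (ψ - χ)
  have h7 := norm_add_le (dAct (ψ - χ) e) (dAct χ e - χ)
  linarith

/-- Invariant of the Cohen construction. -/
def CohenInv (ψ : A →L[ℂ] ℂ) (n : ℕ) (s : A) : Prop :=
  ‖s‖ ≤ 1 - (3 / 4 : ℝ) ^ n ∧ ∃ c K : ℝ, 0 ≤ c ∧ c < 1 ∧ 0 < K ∧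
    (∀ b : A, ‖ψ b‖ ≤ c * ‖((3 / 4 : ℂ) ^ n) • b + s * b‖) ∧
    ∀ b : A, ‖b‖ ≤ K * ‖((3 / 4 : ℂ) ^ n) • b + s * b‖

theorem cohen_step {F : Filter A} [F.NeBot] (hF1 : ∀ᶠ e in F, ‖e‖ ≤ 1)
    (hF2 : ∀ a : A, Tendsto (fun e => a * e) F (𝓝 a)) (ψ : A →L[ℂ] ℂ)
    (hψ : ∀ ε : ℝ, 0 < ε → ∀ᶠ e in F, ‖dAct ψ e - ψ‖ ≤ ε) (n : ℕ) (s : A)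
    (h : CohenInv ψ n s) :
    ∃ s' : A, CohenInv ψ (n + 1) s' ∧ dist s s' ≤ (1 / 4) * (3 / 4 : ℝ) ^ n := by
  obtain ⟨hs, c, K, hc0, hc1, hK, h1, h2⟩ := h
  set ε : ℝ := (1 - c) / (16 * K) with hε
  have hεpos : 0 < ε := div_pos (by linarith) (by positivity)
  have hKε : K * ε = (1 - c) / 16 := by rw [hε]; field_simp
  have hse := (tendsto_iff_norm_sub_tendsto_zero.1 (hF2 s)).eventually (gt_mem_nhds hεpos)
  obtain ⟨e, he1, he2, he3⟩ := (hF1.and ((hψ ε hεpos).and hse)).exists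
  set t : ℂ := (3 / 4 : ℂ) ^ n with ht
  have htn : ‖t‖ = (3 / 4 : ℝ) ^ n := by simp [ht]
  have htpos : 0 < (3 / 4 : ℝ) ^ n := by positivity
  have hdiff : ‖((1 / 4 : ℂ) * t) • e‖ ≤ 1 / 4 * (3 / 4 : ℝ) ^ n := by
    rw [norm_smul, norm_mul, htn]
    have : ‖(1 / 4 : ℂ)‖ = 1 / 4 := by simp
    rw [this]
    calc _ ≤ 1 / 4 * (3 / 4 : ℝ) ^ n * 1 := mul_le_mul_of_nonneg_left he1 (by positivity)
      _ = _ := mul_one _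
  have hT : ∀ b : A, ((3 / 4 : ℂ) ^ (n + 1)) • b + (s + ((1 / 4 : ℂ) * t) • e) * b =
      (t • (b + (1 / 4 : ℂ) • (e * b - b)) + s * (b + (1 / 4 : ℂ) • (e * b - b)))
        - (1 / 4 : ℂ) • ((s * e - s) * b) := by
    intro b
    rw [pow_succ, ← ht]
    simp only [add_mul, mul_add, sub_mul, mul_sub, smul_mul_assoc, mul_smul_comm, mul_assoc]
    module
  have key : ∀ b : A,
      ‖ψ b‖ ≤ c * ‖((3 / 4 : ℂ) ^ (n + 1)) • b + (s + ((1 / 4 : ℂ) * t) • e) * b‖ + 2 * ε * ‖b‖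
      ∧ ‖b‖ ≤ 4 * K * ‖((3 / 4 : ℂ) ^ (n + 1)) • b + (s + ((1 / 4 : ℂ) * t) • e) * b‖ := by
    intro b
    have hTb := hT b
    set U : A := b + (1 / 4 : ℂ) • (e * b - b) with hU
    set T' := ((3 / 4 : ℂ) ^ (n + 1)) • b + (s + ((1 / 4 : ℂ) * t) • e) * b
    have hq : ‖(1 / 4 : ℂ)‖ = 1 / 4 := by simp
    have hb := norm_nonneg b
    have a1 : ‖t • U + s * U‖ ≤ ‖T'‖ + ε * ‖b‖ := by
      have : t • U + s * U = T' + (1 / 4 : ℂ) • ((s * e - s) * b) := by rw [hTb]; abel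
      rw [this]
      refine (norm_add_le _ _).trans ?_
      rw [norm_smul, hq]
      have := norm_mul_le (s * e - s) b
      have := mul_le_mul_of_nonneg_right he3.le hb
      have : 0 ≤ ε * ‖b‖ := by positivity
      linarith
    have a2 : ‖b‖ ≤ 2 * ‖U‖ := by
      have e1 : b = U - (1 / 4 : ℂ) • (e * b - b) := by rw [hU]; abel
      have e2 : ‖b‖ ≤ ‖U‖ + 1 / 4 * ‖e * b - b‖ := by
        conv_lhs => rw [e1]
        refine (norm_sub_le _ _).trans ?_
        rw [norm_smul, hq]
      have e3 := norm_sub_le (e * b) b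
      have e4 := norm_mul_le e b
      have e5 := mul_le_mul_of_nonneg_right he1 hb
      linarith
    have a3 : ‖ψ b‖ ≤ ‖ψ U‖ + ε * ‖b‖ := by
      have e1 : ψ b = ψ U - (1 / 4 : ℂ) * (dAct ψ e - ψ) b := by
        simp [hU, dAct_apply']
      rw [e1]
      refine (norm_sub_le _ _).trans ?_
      rw [norm_mul, hq]
      have e2 := (dAct ψ e - ψ).le_opNorm b
      have e3 := mul_le_mul_of_nonneg_right he2 hb
      have : 0 ≤ ε * ‖b‖ := by positivity
      linarith
    have a4 := h1 U
    have a5 := h2 U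
    have a6 := mul_le_mul_of_nonneg_left a1 hc0
    have a7 := mul_le_mul_of_nonneg_left a1 hK.le
    have hεb : 0 ≤ ε * ‖b‖ := by positivity
    have a8 : c * (ε * ‖b‖) ≤ 1 * (ε * ‖b‖) := mul_le_mul_of_nonneg_right hc1.le hεb
    refine ⟨by linarith, ?_⟩
    have a9 : K * (ε * ‖b‖) ≤ 1 / 16 * ‖b‖ := by
      rw [← mul_assoc, hKε]
      exact mul_le_mul_of_nonneg_right (by linarith) hb
    have a10 : 0 ≤ K * ‖T'‖ := by positivity
    linarith
  refine ⟨s + ((1 / 4 : ℂ) * t) • e, ⟨?_, (1 + c) / 2, 4 * K, by linarith, by linarith,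
    by linarith, ?_, fun b => (key b).2⟩, ?_⟩
  · refine (norm_add_le _ _).trans ?_
    rw [pow_succ]
    linarith
  · intro b
    obtain ⟨k1, k2⟩ := key b
    have k3 := mul_le_mul_of_nonneg_left k2 (show 0 ≤ 2 * ε by positivity)
    set N := ‖((3 / 4 : ℂ) ^ (n + 1)) • b + (s + ((1 / 4 : ℂ) * t) • e) * b‖
    have k4 : 2 * ε * (4 * K * N) = (1 - c) / 2 * N := by
      have : 2 * ε * (4 * K * N) = 8 * (K * ε) * N := by ring
      rw [this, hKε]; ring
    linarith
  · rw [dist_eq_norm]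
    simpa using hdiff

/-- Hahn-Banach step. -/
theorem factor_of_le (ψ : A →L[ℂ] ℂ) (a : A) (h : ∀ b : A, ‖ψ b‖ ≤ ‖a * b‖) :
    ∃ φ : A →L[ℂ] ℂ, ‖φ‖ ≤ 1 ∧ ψ = dAct φ a := by
  let L : A →ₗ[ℂ] A := (ContinuousLinearMap.mul ℂ A a : A →L[ℂ] A)
  have hL : ∀ b, L b = a * b := fun b => rfl
  have hwd : ∀ b b' : A, a * b = a * b' → ψ b = ψ b' := by
    intro b b' hb
    have := h (b - b')
    rw [mul_sub, hb, sub_self, norm_zero, map_sub] at this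
    exact sub_eq_zero.1 (norm_le_zero_iff.1 this)
  have hex : ∀ y : LinearMap.range L, ∃ b, a * b = y := fun y => y.2
  choose g hg using hex
  let f : LinearMap.range L →L[ℂ] ℂ := LinearMap.mkContinuous
    { toFun := fun y => ψ (g y)
      map_add' := fun x y => by
        rw [← map_add]
        apply hwd
        rw [mul_add, hg, hg, hg]; rfl
      map_smul' := fun c x => by
        rw [RingHom.id_apply, ← map_smul]
        apply hwd
        rw [mul_smul_comm, hg, hg]; rfl } 1
    (fun y => by
      rw [one_mul]
      refine (h (g y)).trans ?_
      rw [hg]; rfl)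
  have hf : ‖f‖ ≤ 1 := LinearMap.mkContinuous_norm_le _ zero_le_one _
  obtain ⟨φ, hφ1, hφ2⟩ := exists_extension_norm_eq (LinearMap.range L) f
  refine ⟨φ, hφ2.le.trans hf, ?_⟩
  ext b
  rw [dAct_apply']
  have := hφ1 ⟨a * b, ⟨b, rfl⟩⟩
  refine Eq.trans ?_ this.symm
  exact hwd _ _ (hg ⟨a * b, ⟨b, rfl⟩⟩).symm

theorem cohen_factor [CompleteSpace A] {F : Filter A} [F.NeBot] (hF1 : ∀ᶠ e in F, ‖e‖ ≤ 1)
    (hF2 : ∀ a : A, Tendsto (fun e => a * e) F (𝓝 a)) (ψ : A →L[ℂ] ℂ)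
    (hψ : ∀ ε : ℝ, 0 < ε → ∀ᶠ e in F, ‖dAct ψ e - ψ‖ ≤ ε) (hn : ‖ψ‖ < 1) :
    ∃ (φ : A →L[ℂ] ℂ) (a : A), ‖φ‖ ≤ 1 ∧ ‖a‖ ≤ 1 ∧ ψ = dAct φ a := by
  choose! nxt hnxt using cohen_step hF1 hF2 ψ hψ
  let s : ℕ → A := fun n => Nat.rec 0 (fun k x => nxt k x) n
  have hs : ∀ n, s (n + 1) = nxt n (s n) := fun n => rfl
  have hinv : ∀ n, CohenInv ψ n (s n) := by
    intro n
    induction n with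
    | zero =>
      refine ⟨by simp [s], ‖ψ‖, 1, norm_nonneg _, hn, one_pos, fun b => ?_, fun b => ?_⟩
      · simpa [s] using ψ.le_opNorm b
      · simp [s]
    | succ k ih => rw [hs]; exact (hnxt k _ ih).1
  have hd : ∀ n, dist (s n) (s (n + 1)) ≤ 1 / 4 * (3 / 4 : ℝ) ^ n := fun n => by
    rw [hs]; exact (hnxt n _ (hinv n)).2
  obtain ⟨a, ha⟩ := cauchySeq_tendsto_of_complete
    (cauchySeq_of_le_geometric (3 / 4 : ℝ) (1 / 4) (by norm_num) hd)
  have ha1 : ‖a‖ ≤ 1 := le_of_tendsto' ha.norm fun n => (hinv n).1.trans (by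
    have : 0 < (3 / 4 : ℝ) ^ n := by positivity
    linarith)
  have hle : ∀ b : A, ‖ψ b‖ ≤ ‖a * b‖ := by
    intro b
    have h1 : Tendsto (fun n : ℕ => (3 / 4 : ℂ) ^ n) atTop (𝓝 0) :=
      tendsto_pow_atTop_nhds_zero_of_norm_lt_one (by simp; norm_num)
    have h2 : Tendsto (fun n : ℕ => ‖((3 / 4 : ℂ) ^ n) • b + s n * b‖) atTop (𝓝 ‖a * b‖) := by
      have := ((h1.smul_const b).add (ha.mul_const b)).norm
      simpa using this
    refine ge_of_tendsto' h2 fun n => ?_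
    obtain ⟨_, c, K, hc0, hc1, hK, h3, _⟩ := hinv n
    refine (h3 b).trans ?_
    exact mul_le_of_le_one_left (norm_nonneg _) hc1.le
  obtain ⟨φ, hφ, he⟩ := factor_of_le ψ a hle
  exact ⟨φ, a, hφ, ha1, he⟩

/-- Absolutely convergent sums of coefficient functionals. -/
theorem hasSum_of_fq (φ : A →L[ℂ] ℂ) (xs : ℕ → (A →L[ℂ] ℂ)) (x : ℕ → A)
    (hsum : Summable fun n => ‖xs n‖ * ‖x n‖)
    (h : ∀ a : A, HasSum (fun n => xs n (ContinuousLinearMap.mul ℂ A (x n) a)) (φ a)) :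
    HasSum (fun n => dAct (xs n) (x n)) φ := by
  have h1 : Summable (fun n => dAct (xs n) (x n)) :=
    Summable.of_norm_bounded hsum fun n => norm_dAct_le _ _
  have h2 : (∑' n, dAct (xs n) (x n)) = φ := by
    ext a
    have h3 := h1.hasSum.mapL (ContinuousLinearMap.apply ℂ ℂ a)
    exact h3.unique (h a)
  rw [← h2]
  exact h1.hasSum

theorem single_rep (φ : A →L[ℂ] ℂ) (a : A) :
    ∃ (xs : ℕ → (A →L[ℂ] ℂ)) (x : ℕ → A),
      HasSum (fun n => ‖xs n‖ * ‖x n‖) (‖φ‖ * ‖a‖) ∧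
      ∀ b : A, HasSum (fun n => xs n (ContinuousLinearMap.mul ℂ A (x n) b)) (dAct φ a b) := by
  refine ⟨fun n => if n = 0 then φ else 0, fun n => if n = 0 then a else 0, ?_, fun b => ?_⟩
  · have := hasSum_ite_eq (0 : ℕ) (‖φ‖ * ‖a‖)
    refine this.congr_fun ?_ |> fun h => h
    intro n
    by_cases hn : n = 0 <;> simp [hn]
  · have := hasSum_ite_eq (0 : ℕ) (dAct φ a b)
    refine this.congr_fun ?_ |> fun h => h
    intro n
    by_cases hn : n = 0 <;> simp [hn, dAct_apply']

end helpers

/-- Let `A` be a complex Banach algebra with a contractive right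
approximate identity (formulated by a filter on `A`), and regard `X = A` as a right
`A`-module via multiplication, so that the coefficient functionals are exactly the
functionals `φ·a`.  Let `LUC(A*)` be the closed linear span of `{φ·a}`.  Then:
(i) every element of `LUC(A*)` factors as a single product `φ·a`;
(ii) the open unit ball of `LUC(A*)` is contained in `{φ·a : ‖φ‖ ≤ 1, ‖a‖ ≤ 1}`,
which is contained in the closed unit ball of `LUC(A*)`;
(iii) `F_q(A*) = LUC(A*)` and `‖·‖_q = ‖·‖_{A*}` on this common space. -/
theorem statement_15
    {A : Type*} [NonUnitalNormedRing A] [NormedSpace ℂ A] [CompleteSpace A]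
    [IsScalarTower ℂ A A] [SMulCommClass ℂ A A]
    (hrai : ∃ F : Filter A, F.NeBot ∧ (∀ᶠ e in F, ‖e‖ ≤ 1) ∧
      ∀ a : A, Tendsto (fun e => a * e) F (𝓝 a))
    (LUC : Set (A →L[ℂ] ℂ))
    (hLUC : LUC = closure
      (Submodule.span ℂ {ψ : A →L[ℂ] ℂ | ∃ (φ : A →L[ℂ] ℂ) (a : A), ψ = dAct φ a} :
        Set (A →L[ℂ] ℂ))) :
    -- (i) factorization
    (LUC = {ψ : A →L[ℂ] ℂ | ∃ (φ : A →L[ℂ] ℂ) (a : A), ψ = dAct φ a}) ∧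
    -- (ii) unit-ball inclusions
    (∀ ψ ∈ LUC, ‖ψ‖ < 1 →
      ∃ (φ : A →L[ℂ] ℂ) (a : A), ‖φ‖ ≤ 1 ∧ ‖a‖ ≤ 1 ∧ ψ = dAct φ a) ∧
    (∀ (φ : A →L[ℂ] ℂ) (a : A), ‖φ‖ ≤ 1 → ‖a‖ ≤ 1 →
      dAct φ a ∈ LUC ∧ ‖dAct φ a‖ ≤ 1) ∧
    -- (iii) `F_q(A*) = LUC(A*)` isometrically
    ({φ : A →L[ℂ] ℂ | FqMem (ContinuousLinearMap.mul ℂ A) φ} = LUC) ∧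
    (∀ ψ ∈ LUC, qNorm (ContinuousLinearMap.mul ℂ A) ψ = ‖ψ‖) := by
  obtain ⟨F, hF, hF1, hF2⟩ := hrai
  have hsub : ∀ (φ : A →L[ℂ] ℂ) (a : A), dAct φ a ∈ LUC := fun φ a => by
    rw [hLUC]; exact subset_closure (Submodule.subset_span ⟨φ, a, rfl⟩)
  have hball : ∀ ψ ∈ LUC, ‖ψ‖ < 1 →
      ∃ (φ : A →L[ℂ] ℂ) (a : A), ‖φ‖ ≤ 1 ∧ ‖a‖ ≤ 1 ∧ ψ = dAct φ a := by
    intro ψ hψ hn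
    rw [hLUC] at hψ
    exact cohen_factor hF1 hF2 ψ (luc_tendsto hF1 hF2 ψ hψ) hn
  have hscale : ∀ ψ ∈ LUC, ∀ r : ℝ, ‖ψ‖ < r →
      ∃ (φ : A →L[ℂ] ℂ) (a : A), ‖φ‖ * ‖a‖ ≤ r ∧ ψ = dAct φ a := by
    intro ψ hψ r hr
    have hr0 : 0 < r := (norm_nonneg _).trans_lt hr
    have hrc : (r : ℂ) ≠ 0 := by exact_mod_cast hr0.ne'
    have hrn : ‖(r : ℂ)‖ = r := by simp [abs_of_pos hr0]
    have hmem : ((r : ℂ)⁻¹) • ψ ∈ LUC := by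
      rw [hLUC] at hψ ⊢
      rw [← Submodule.topologicalClosure_coe] at hψ ⊢
      exact Submodule.smul_mem _ _ hψ
    obtain ⟨φ, a, hφ, ha, he⟩ := hball _ hmem (by
      rw [norm_smul, norm_inv, hrn, inv_mul_lt_iff₀ hr0]; linarith)
    refine ⟨(r : ℂ) • φ, a, ?_, ?_⟩
    · rw [norm_smul, hrn, mul_assoc]
      exact mul_le_of_le_one_right hr0.le (mul_le_one₀ hφ (norm_nonneg _) ha)
    · have h1 : dAct ((r : ℂ) • φ) a = (r : ℂ) • dAct φ a := by
        ext b; simp [dAct_apply']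
      rw [h1, ← he, smul_smul, mul_inv_cancel₀ hrc, one_smul]
  refine ⟨?_, hball, ?_, ?_, ?_⟩
  · ext ψ
    constructor
    · intro hψ
      obtain ⟨φ, a, _, h⟩ := hscale ψ hψ (‖ψ‖ + 1) (by linarith)
      exact ⟨φ, a, h⟩
    · rintro ⟨φ, a, rfl⟩
      exact hsub φ a
  · intro φ a hφ ha
    exact ⟨hsub φ a, (norm_dAct_le φ a).trans (mul_le_one₀ hφ (norm_nonneg _) ha)⟩
  · ext ψ
    constructor
    · rintro ⟨xs, x, h1, h2⟩
      have h3 := hasSum_of_fq ψ xs x h1 h2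
      rw [hLUC]
      refine mem_closure_of_tendsto h3 (Eventually.of_forall fun s => ?_)
      exact Submodule.sum_mem _ fun n _ => Submodule.subset_span ⟨_, _, rfl⟩
    · intro hψ
      obtain ⟨φ, a, _, rfl⟩ := hscale ψ hψ (‖ψ‖ + 1) (by linarith)
      obtain ⟨xs, x, h1, h2⟩ := single_rep φ a
      exact ⟨xs, x, h1.summable, h2⟩
  · intro ψ hψ
    have hlow : ∀ c ∈ { c : ℝ | ∃ (xs : ℕ → (A →L[ℂ] ℂ)) (x : ℕ → A),
        (Summable fun n => ‖xs n‖ * ‖x n‖) ∧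
        (∀ a : A, HasSum (fun n => xs n (ContinuousLinearMap.mul ℂ A (x n) a)) (ψ a)) ∧
        c = ∑' n, ‖xs n‖ * ‖x n‖ }, ‖ψ‖ ≤ c := by
      rintro c ⟨xs, x, h1, h2, rfl⟩
      exact (hasSum_of_fq ψ xs x h1 h2).norm_le_of_bounded h1.hasSum fun n => norm_dAct_le _ _
    have hrep : ∀ r : ℝ, ‖ψ‖ < r → ∃ c ∈ { c : ℝ | ∃ (xs : ℕ → (A →L[ℂ] ℂ)) (x : ℕ → A),
        (Summable fun n => ‖xs n‖ * ‖x n‖) ∧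
        (∀ a : A, HasSum (fun n => xs n (ContinuousLinearMap.mul ℂ A (x n) a)) (ψ a)) ∧
        c = ∑' n, ‖xs n‖ * ‖x n‖ }, c ≤ r := by
      intro r hr
      obtain ⟨φ, a, h, rfl⟩ := hscale ψ hψ r hr
      obtain ⟨xs, x, h1, h2⟩ := single_rep φ a
      exact ⟨_, ⟨xs, x, h1.summable, h2, h1.tsum_eq.symm⟩, h⟩
    unfold qNorm
    apply le_antisymm
    · refine le_of_forall_gt_imp_ge_of_dense fun r hr => ?_
      obtain ⟨c, hc, hcr⟩ := hrep r hr
      exact (csInf_le ⟨‖ψ‖, hlow⟩ hc).trans hcr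
    · obtain ⟨c, hc, _⟩ := hrep (‖ψ‖ + 1) (by linarith)
      exact le_csInf ⟨c, hc⟩ hlow

end
end
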